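/- Let S ⊆ Γ = SL₂(ℤ)×SL₂(ℤ)×SL₂(ℤ) be a finite symmetric set generating a group that is Zariski-dense in SL₂×SL₂×SL₂. Then there exist c > 0 and Q₀, depending only on S, such that the following holds. Let Q ≥ Q₀ be an integer, and let ξ = (ξ₁,ξ₂,ξ₃), η = (η₁,η₂,η₃) ∈ Mat₂(ℤ)³ satisfy Tr(ξᵢ) = Tr(ηᵢ) = 0 for i = 1,2,3, and ξᵢ ≢ 0 (mod p) and ηᵢ ≢ 0 (mod p) for every prime p | Q and every i. Define κᵢ(g) = Tr(g ξᵢ g⁻¹ ηᵢ) for g ∈ SL₂(ℤ). Then for every integer l > log Q, χ_S^{(l)}({(g₁,g₂,g₃) ∈ Γ : κ₁(g₁) + κ₂(g₂) + κ₃(g₃) ≡ 0 (mod Q)}) < Q^{−c}. -/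

import Mathlib

open Matrix Pointwise

abbrev SL2Z := Matrix.SpecialLinearGroup (Fin 2) ℤ
abbrev SL2C := Matrix.SpecialLinearGroup (Fin 2) ℂ
abbrev GammaSL : Type := SL2Z × SL2Z × SL2Z
abbrev GammaC : Type := SL2C × SL2C × SL2C

def entryZ (g : GammaSL) : Fin 3 × Fin 2 × Fin 2 → ℤ :=
  fun x => ![(g.1 : Matrix (Fin 2) (Fin 2) ℤ), (g.2.1 : Matrix (Fin 2) (Fin 2) ℤ),
    (g.2.2 : Matrix (Fin 2) (Fin 2) ℤ)] x.1 x.2.1 x.2.2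

noncomputable def entryC (g : GammaC) : Fin 3 × Fin 2 × Fin 2 → ℂ :=
  fun x => ![(g.1 : Matrix (Fin 2) (Fin 2) ℂ), (g.2.1 : Matrix (Fin 2) (Fin 2) ℂ),
    (g.2.2 : Matrix (Fin 2) (Fin 2) ℂ)] x.1 x.2.1 x.2.2

/-- Zariski density of a subgroup of `SL₂(ℤ)³` in `SL₂ × SL₂ × SL₂`. -/
def ZariskiDense (G : Subgroup GammaSL) : Prop :=
  ∀ P : MvPolynomial (Fin 3 × Fin 2 × Fin 2) ℚ,
    (∀ g ∈ G, (MvPolynomial.aeval (fun x => (entryZ g x : ℂ))) P = 0) →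
    ∀ h : GammaC, (MvPolynomial.aeval (entryC h)) P = 0

/-- Entrywise reduction mod `q` on `SL₂(ℤ)`. -/
def redSL (q : ℕ) : SL2Z →* Matrix.SpecialLinearGroup (Fin 2) (ZMod q) :=
  Matrix.SpecialLinearGroup.map (Int.castRingHom (ZMod q))

abbrev GammaMod (q : ℕ) : Type :=
  Matrix.SpecialLinearGroup (Fin 2) (ZMod q) × Matrix.SpecialLinearGroup (Fin 2) (ZMod q) ×
    Matrix.SpecialLinearGroup (Fin 2) (ZMod q)

/-- Entrywise reduction mod `q` on `Γ = SL₂(ℤ)³`. -/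
def piq (q : ℕ) : GammaSL →* GammaMod q :=
  (redSL q).prodMap ((redSL q).prodMap (redSL q))

/-- convolution on Γ -/
noncomputable def convG (f g : GammaSL → ℝ) : GammaSL → ℝ := fun x => ∑ᶠ y, f y * g (x * y⁻¹)

/-- normalized counting measure on S -/
noncomputable def chiS (S : Set GammaSL) : GammaSL → ℝ := S.indicator fun _ => (S.ncard : ℝ)⁻¹

/-- l-fold convolution of χ_S with itself -/
noncomputable def chiIter (S : Set GammaSL) : ℕ → GammaSL → ℝ
  | 0 => fun x => open Classical in if x = 1 then 1 else 0
  | n + 1 => convG (chiS S) (chiIter S n)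

/-- The expectation of `φ` over the product of `n` independent uniform elements of `T`. -/
noncomputable def walkExp {G : Type*} [Group G] (T : Finset G) : ℕ → (G → ℝ) → ℝ
  | 0, φ => φ 1
  | n + 1, φ => (T.card : ℝ)⁻¹ * ∑ s ∈ T, walkExp T n (fun x => φ (x * s))

section walkExp
variable {G : Type*} [Group G] {T : Finset G}

lemma walkExp_finset_sum {ι : Type*} (A : Finset ι) (n : ℕ) (φ : ι → G → ℝ) :
    walkExp T n (fun x => ∑ i ∈ A, φ i x) = ∑ i ∈ A, walkExp T n (φ i) := by
  induction n generalizing φ with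
  | zero => rfl
  | succ n ih =>
    simp only [walkExp]
    simp_rw [ih]
    rw [Finset.sum_comm, Finset.mul_sum]

lemma walkExp_mul_left (c : ℝ) (n : ℕ) (φ : G → ℝ) :
    walkExp T n (fun x => c * φ x) = c * walkExp T n φ := by
  induction n generalizing φ with
  | zero => rfl
  | succ n ih =>
    simp only [walkExp]
    simp_rw [ih]
    rw [← Finset.mul_sum]
    ring

lemma walkExp_add (n : ℕ) (φ ψ : G → ℝ) :
    walkExp T n (fun x => φ x + ψ x) = walkExp T n φ + walkExp T n ψ := by
  induction n generalizing φ ψ with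
  | zero => rfl
  | succ n ih =>
    simp only [walkExp]
    simp_rw [ih]
    rw [Finset.sum_add_distrib, mul_add]

lemma walkExp_const (hT : T.Nonempty) (n : ℕ) (c : ℝ) :
    walkExp T n (fun _ => c) = c := by
  induction n with
  | zero => rfl
  | succ n ih =>
    have : (T.card : ℝ) ≠ 0 := by exact_mod_cast hT.card_pos.ne'
    simp only [walkExp, ih, Finset.sum_const, nsmul_eq_mul]
    field_simp

lemma walkExp_mono {n : ℕ} {φ ψ : G → ℝ} (h : ∀ x, φ x ≤ ψ x) :
    walkExp T n φ ≤ walkExp T n ψ := by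
  induction n generalizing φ ψ with
  | zero => exact h 1
  | succ n ih =>
    simp only [walkExp]
    exact mul_le_mul_of_nonneg_left (Finset.sum_le_sum fun s _ => ih fun x => h _) (by positivity)

lemma walkExp_nonneg {n : ℕ} {φ : G → ℝ} (h : ∀ x, 0 ≤ φ x) : 0 ≤ walkExp T n φ := by
  induction n generalizing φ with
  | zero => exact h 1
  | succ n ih =>
    simp only [walkExp]
    exact mul_nonneg (by positivity) (Finset.sum_nonneg fun s _ => ih fun x => h _)

lemma walkExp_congr_of_mem {B : ℕ → Set G} (h1 : 1 ∈ B 0)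
    (hB : ∀ n, ∀ x ∈ B n, ∀ s ∈ T, x * s ∈ B (n + 1)) {n : ℕ} {φ ψ : G → ℝ}
    (h : ∀ x ∈ B n, φ x = ψ x) : walkExp T n φ = walkExp T n ψ := by
  induction n generalizing φ ψ with
  | zero => exact h 1 h1
  | succ n ih =>
    simp only [walkExp]
    congr 1
    exact Finset.sum_congr rfl fun s hs => ih fun x hx => h _ (hB n x hx s hs)

lemma walkExp_comp_add (m n : ℕ) (φ : G → ℝ) :
    walkExp T (m + n) φ = walkExp T m (fun x => walkExp T n (fun y => φ (x * y))) := by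
  induction n generalizing φ with
  | zero => simp [walkExp]
  | succ n ih =>
    rw [← add_assoc]
    simp only [walkExp]
    rw [walkExp_mul_left, walkExp_finset_sum]
    congr 1
    refine Finset.sum_congr rfl fun s _ => ?_
    rw [ih]
    simp only [mul_assoc]

lemma walkExp_comm (m n : ℕ) (φ : G → G → ℝ) :
    walkExp T m (fun x => walkExp T n (φ x)) =
      walkExp T n (fun y => walkExp T m (fun x => φ x y)) := by
  induction n generalizing φ with
  | zero => rfl
  | succ n ih =>
    simp only [walkExp]
    rw [walkExp_mul_left, walkExp_finset_sum]
    congr 1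
    refine Finset.sum_congr rfl fun s _ => ?_
    rw [ih]

lemma walkExp_inv (hT : ∀ s ∈ T, s⁻¹ ∈ T) (n : ℕ) (φ : G → ℝ) :
    walkExp T n (fun x => φ x⁻¹) = walkExp T n φ := by
  induction n generalizing φ with
  | zero => simp [walkExp]
  | succ n ih =>
    have h1 : walkExp T (n + 1) (fun x => φ x⁻¹) =
        (T.card : ℝ)⁻¹ * ∑ s ∈ T, walkExp T n (fun x => φ (s⁻¹ * x)) := by
      simp only [walkExp]
      congr 1
      refine Finset.sum_congr rfl fun s _ => ?_
      rw [← ih]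
      simp
    have h2 : ∑ s ∈ T, walkExp T n (fun x => φ (s⁻¹ * x)) =
        ∑ s ∈ T, walkExp T n (fun x => φ (s * x)) :=
      Finset.sum_nbij' (fun s => s⁻¹) (fun s => s⁻¹) hT hT (by simp) (by simp) (by simp)
    rw [h1, h2, add_comm n 1, walkExp_comp_add]
    simp [walkExp]

lemma sq_walkExp_le (hT : T.Nonempty) (n : ℕ) (φ : G → ℝ) :
    walkExp T n φ ^ 2 ≤ walkExp T n (fun x => φ x ^ 2) := by
  set c := walkExp T n φ with hc
  have h := walkExp_nonneg (T := T) (n := n) (φ := fun x => (φ x - c) ^ 2) fun x => sq_nonneg _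
  have h2 : (fun x => (φ x - c) ^ 2) = fun x => φ x ^ 2 + ((-2 * c) * φ x + c ^ 2) := by
    funext x; ring
  rw [h2, walkExp_add, walkExp_add, walkExp_mul_left, walkExp_const hT, ← hc] at h
  nlinarith

lemma exists_walkExp_eq_sum [DecidableEq G] (n : ℕ) :
    ∃ B : Finset G, ∀ φ : G → ℝ,
      walkExp T n φ = ∑ g ∈ B, φ g * walkExp T n (fun x => if x = g then 1 else 0) := by
  induction n with
  | zero =>
    refine ⟨{1}, fun φ => ?_⟩
    simp [walkExp]
  | succ n ih =>
    obtain ⟨B, hB⟩ := ih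
    refine ⟨B * T, fun φ => ?_⟩
    simp only [walkExp]
    simp_rw [mul_left_comm _ (T.card : ℝ)⁻¹, Finset.mul_sum]
    rw [Finset.sum_comm]
    refine Finset.sum_congr rfl fun s hs => ?_
    rw [← Finset.mul_sum]
    congr 1
    have h1 : ∀ z : G, (fun x => if x * s = z then (1 : ℝ) else 0) =
        fun x => if x = z * s⁻¹ then 1 else 0 := by
      intro z; funext x; simp only [eq_mul_inv_iff_mul_eq]
    simp_rw [h1]
    rw [hB]
    have h3 : ∀ g ∉ B, walkExp T n (fun x => if x = g then (1 : ℝ) else 0) = 0 := by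
      intro g hg
      rw [hB]
      refine Finset.sum_eq_zero fun x hx => ?_
      rw [if_neg, zero_mul]
      rintro rfl
      exact hg hx
    symm
    have h4 : ∑ z ∈ B * T, φ z * walkExp T n (fun x => if x = z * s⁻¹ then 1 else 0) =
        ∑ z ∈ B.map (mulRightEmbedding s), φ z * walkExp T n (fun x => if x = z * s⁻¹ then 1 else 0) := by
      symm
      apply Finset.sum_subset
      · intro z hz
        obtain ⟨b, hb, rfl⟩ := Finset.mem_map.1 hz
        exact Finset.mul_mem_mul hb hs
      · intro z _ hz
        rw [h3, mul_zero]
        intro hz'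
        apply hz
        exact Finset.mem_map.2 ⟨_, hz', by simp [mulRightEmbedding]⟩
    rw [h4, Finset.sum_map]
    simp [mulRightEmbedding]

end walkExp

open Classical in
lemma chiIter_eq_walkExp {S : Set GammaSL} (hS : S.Finite) (n : ℕ) (g : GammaSL) :
    chiIter S n g = walkExp hS.toFinset n (fun x => if x = g then 1 else 0) := by
  induction n generalizing g with
  | zero => simp [chiIter, walkExp, eq_comm]
  | succ n ih =>
    have hc : S.ncard = hS.toFinset.card := Set.ncard_eq_toFinset_card S hS
    simp only [chiIter, convG, walkExp]
    rw [finsum_eq_sum_of_support_subset (s := hS.toFinset)]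
    · rw [Finset.mul_sum]
      refine Finset.sum_congr rfl fun s hs => ?_
      rw [chiS, Set.indicator_of_mem (by simpa using hs), hc, ih]
      simp only [eq_mul_inv_iff_mul_eq]
    · intro x hx
      by_contra hx'
      apply hx
      simp only [Set.Finite.coe_toFinset] at hx'
      simp [chiS, hx']

open Classical in
lemma finsum_chiIter_eq_walkExp {S : Set GammaSL} (hS : S.Finite) (n : ℕ) (A : Set GammaSL) :
    ∑ᶠ g ∈ A, chiIter S n g = walkExp hS.toFinset n (fun x => if x ∈ A then 1 else 0) := by
  obtain ⟨B, hB⟩ := exists_walkExp_eq_sum (T := hS.toFinset) n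
  rw [hB, finsum_eq_sum_of_support_subset (s := B)]
  · refine Finset.sum_congr rfl fun g _ => ?_
    rw [chiIter_eq_walkExp hS]
    by_cases h : g ∈ A <;> simp [h]
  · intro g hg
    by_contra hg'
    apply hg
    have : chiIter S n g = 0 := by
      rw [chiIter_eq_walkExp hS, hB]
      refine Finset.sum_eq_zero fun x hx => ?_
      rw [if_neg, zero_mul]
      rintro rfl
      exact hg' hx
    simp [this]

section shift
variable {G : Type*} [Group G] {X : Type*} [MulAction G X]

lemma memℓp_comp_smul (g : G) (f : lp (fun _ : X => ℝ) 2) :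
    Memℓp (fun x => f (g • x)) 2 := by
  have h := (memℓp_gen_iff (p := 2) (by norm_num)).1 (lp.memℓp f)
  exact (memℓp_gen_iff (p := 2) (by norm_num)).2
    ((MulAction.toPerm (g : G) : Equiv.Perm X).summable_iff.2 h)

/-- The permutation action of a group on the space of square-summable functions. -/
noncomputable def ellTwoShift (g : G) : lp (fun _ : X => ℝ) 2 →ₗᵢ[ℝ] lp (fun _ : X => ℝ) 2 where
  toFun f := ⟨fun x => f (g⁻¹ • x), memℓp_comp_smul g⁻¹ f⟩
  map_add' f h := by ext x; rfl
  map_smul' c f := by ext x; rfl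
  norm_map' f := by
    have key : ‖(⟨fun x => f (g⁻¹ • x), memℓp_comp_smul g⁻¹ f⟩ : lp (fun _ : X => ℝ) 2)‖ ^ (2 : ENNReal).toReal =
        ‖f‖ ^ (2 : ENNReal).toReal := by
      rw [lp.norm_rpow_eq_tsum (by norm_num), lp.norm_rpow_eq_tsum (by norm_num)]
      exact (MulAction.toPerm (g⁻¹ : G) : Equiv.Perm X).tsum_eq
        (fun x => ‖f x‖ ^ (2 : ENNReal).toReal)
    exact (Real.rpow_left_inj (norm_nonneg _) (norm_nonneg _) (by norm_num)).1 key

lemma ellTwoShift_apply (g : G) (f : lp (fun _ : X => ℝ) 2) (x : X) :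
    ellTwoShift g f x = f (g⁻¹ • x) := rfl

lemma ellTwoShift_mul (g h : G) (f : lp (fun _ : X => ℝ) 2) :
    ellTwoShift (g * h) f = ellTwoShift g (ellTwoShift h f) := by
  ext x
  simp [ellTwoShift_apply, mul_smul]

lemma ellTwoShift_one (f : lp (fun _ : X => ℝ) 2) : ellTwoShift (1 : G) f = f := by
  ext x
  simp [ellTwoShift_apply]

open Classical in
lemma ellTwoShift_single (g : G) (x : X) :
    ellTwoShift g (lp.single 2 x (1 : ℝ)) = lp.single 2 (g • x) (1 : ℝ) := by
  ext y
  simp only [ellTwoShift_apply, lp.single_apply, Pi.single_apply, inv_smul_eq_iff]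

lemma norm_sq_eq_tsum_sq (f : lp (fun _ : X => ℝ) 2) : ‖f‖ ^ 2 = ∑' x, f x ^ 2 := by
  have := lp.norm_rpow_eq_tsum (p := 2) (by norm_num) f
  simpa using this

lemma summable_sq (f : lp (fun _ : X => ℝ) 2) : Summable fun x => f x ^ 2 := by
  have := (memℓp_gen_iff (p := 2) (by norm_num)).1 (lp.memℓp f)
  simpa using this

/-- The averaging operator over `T` on square-summable functions. -/
noncomputable def ellTwoMean (T : Finset G) : lp (fun _ : X => ℝ) 2 →ₗ[ℝ] lp (fun _ : X => ℝ) 2 :=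
  (T.card : ℝ)⁻¹ • ∑ s ∈ T, (ellTwoShift s).toLinearMap

lemma ellTwoMean_apply (T : Finset G) (f : lp (fun _ : X => ℝ) 2) :
    ellTwoMean T f = (T.card : ℝ)⁻¹ • ∑ s ∈ T, ellTwoShift s f := by
  simp [ellTwoMean]

lemma sum_norm_sub_ellTwoMean_sq {T : Finset G} (hT : T.Nonempty) (f : lp (fun _ : X => ℝ) 2) :
    ∑ s ∈ T, ‖ellTwoShift s f - ellTwoMean T f‖ ^ 2 =
      T.card * (‖f‖ ^ 2 - ‖ellTwoMean T f‖ ^ 2) := by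
  have hc : (T.card : ℝ) ≠ 0 := by exact_mod_cast hT.card_pos.ne'
  have h1 : ∑ s ∈ T, ellTwoShift s f = (T.card : ℝ) • ellTwoMean T f := by
    rw [ellTwoMean_apply, smul_smul, mul_inv_cancel₀ hc, one_smul]
  simp_rw [norm_sub_sq_real, LinearIsometry.norm_map]
  rw [Finset.sum_add_distrib, Finset.sum_sub_distrib, ← Finset.mul_sum, ← sum_inner, h1,
    inner_smul_left, real_inner_self_eq_norm_sq]
  simp
  ring

lemma norm_ellTwoMean_le {T : Finset G} (hT : T.Nonempty) (f : lp (fun _ : X => ℝ) 2) :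
    0 ≤ ‖f‖ ^ 2 - ‖ellTwoMean T f‖ ^ 2 := by
  have hc : (0 : ℝ) < T.card := by exact_mod_cast hT.card_pos
  have h := sum_norm_sub_ellTwoMean_sq hT f
  have h2 : 0 ≤ ∑ s ∈ T, ‖ellTwoShift s f - ellTwoMean T f‖ ^ 2 := by positivity
  rw [h] at h2
  exact nonneg_of_mul_nonneg_right h2 hc

lemma norm_ellTwoShift_sub_le {T : Finset G} {s t : G} (hs : s ∈ T) (ht : t ∈ T)
    (f : lp (fun _ : X => ℝ) 2) :
    ‖ellTwoShift s f - ellTwoShift t f‖ ≤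
      2 * √T.card * √(‖f‖ ^ 2 - ‖ellTwoMean T f‖ ^ 2) := by
  have key : ∀ s ∈ T, ‖ellTwoShift s f - ellTwoMean T f‖ ≤
      √T.card * √(‖f‖ ^ 2 - ‖ellTwoMean T f‖ ^ 2) := by
    intro s hs
    rw [← Real.sqrt_mul (by positivity), ← sum_norm_sub_ellTwoMean_sq ⟨s, hs⟩]
    refine Real.le_sqrt_of_sq_le ?_
    exact Finset.single_le_sum (f := fun s => ‖ellTwoShift s f - ellTwoMean T f‖ ^ 2)
      (fun _ _ => by positivity) hs
  have h := norm_sub_le_norm_sub_add_norm_sub (ellTwoShift s f) (ellTwoMean T f) (ellTwoShift t f)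
  rw [norm_sub_rev (ellTwoMean T f)] at h
  linarith [key s hs, key t ht]

open Classical in
lemma walkExp_inner_ellTwoShift (T : Finset G) (n : ℕ) (u v : lp (fun _ : X => ℝ) 2) :
    walkExp T n (fun g => inner ℝ (ellTwoShift g u) v) = inner ℝ ((ellTwoMean T ^ n) u) v := by
  induction n generalizing u with
  | zero => simp [walkExp, ellTwoShift_one]
  | succ n ih =>
    simp only [walkExp]
    simp_rw [ellTwoShift_mul, ih]
    rw [pow_succ, Module.End.mul_apply, ellTwoMean_apply, map_smul, map_sum, inner_smul_left,
      sum_inner]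
    simp

open Classical in
lemma walkExp_return_le {T : Finset G} {r : ℝ} (hr : 0 ≤ r)
    (h : ∀ f : lp (fun _ : X => ℝ) 2, ‖ellTwoMean T f‖ ≤ r * ‖f‖) (x : X) (n : ℕ) :
    walkExp T n (fun g => if g • x = x then 1 else 0) ≤ r ^ n := by
  set u : lp (fun _ : X => ℝ) 2 := lp.single 2 x (1 : ℝ) with hu
  have hun : ‖u‖ = 1 := by
    rw [hu, lp.norm_single (by norm_num)]; simp
  have h1 : (fun g : G => if g • x = x then (1 : ℝ) else 0) =
      fun g => inner ℝ (ellTwoShift g u) u := by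
    funext g
    rw [hu, ellTwoShift_single, lp.inner_single_left]
    simp [lp.single_apply, Pi.single_apply, eq_comm]
  rw [h1, walkExp_inner_ellTwoShift]
  have h2 : ‖(ellTwoMean T ^ n) u‖ ≤ r ^ n := by
    clear h1
    induction n with
    | zero => simp [hun]
    | succ n ih =>
      rw [pow_succ', Module.End.mul_apply, pow_succ']
      exact (h _).trans (mul_le_mul_of_nonneg_left ih hr)
  calc _ ≤ ‖(ellTwoMean T ^ n) u‖ * ‖u‖ := real_inner_le_norm _ _
    _ ≤ _ := by rw [hun, mul_one]; exact h2

end shift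

/-- `g` moves every square-summable function on a `G`-set by at most a constant times the defect
of the averaging operator over `T`. -/
def DefectControlled {G : Type} [Group G] (T : Finset G) (g : G) : Prop :=
  ∃ K : ℝ, 0 ≤ K ∧ ∀ (X : Type) [MulAction G X] (f : lp (fun _ : X => ℝ) 2),
    ‖ellTwoShift g f - f‖ ≤ K * √(‖f‖ ^ 2 - ‖ellTwoMean T f‖ ^ 2)

section defect
variable {G : Type} [Group G] {T : Finset G}

lemma DefectControlled.one : DefectControlled T (1 : G) :=
  ⟨0, le_rfl, fun X _ f => by simp [ellTwoShift_one]⟩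

lemma DefectControlled.mul {g h : G} (hg : DefectControlled T g) (hh : DefectControlled T h) :
    DefectControlled T (g * h) := by
  obtain ⟨K, hK, h1⟩ := hg
  obtain ⟨L, hL, h2⟩ := hh
  refine ⟨K + L, by positivity, fun X _ f => ?_⟩
  have h3 : ellTwoShift (g * h) f - f =
      ellTwoShift g (ellTwoShift h f - f) + (ellTwoShift g f - f) := by
    rw [ellTwoShift_mul, map_sub]; abel
  rw [h3]
  refine (norm_add_le _ _).trans ?_
  rw [LinearIsometry.norm_map]
  linarith [h1 X f, h2 X f]

lemma DefectControlled.mul_of_mem (hT : ∀ s ∈ T, s⁻¹ ∈ T) {s t : G} (hs : s ∈ T) (ht : t ∈ T) :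
    DefectControlled T (s * t) := by
  refine ⟨2 * √T.card, by positivity, fun X _ f => ?_⟩
  have h3 : ellTwoShift (s * t) f - f = ellTwoShift s (ellTwoShift t f - ellTwoShift s⁻¹ f) := by
    rw [ellTwoShift_mul, map_sub, ← ellTwoShift_mul s s⁻¹, mul_inv_cancel, ellTwoShift_one]
  rw [h3, LinearIsometry.norm_map]
  exact norm_ellTwoShift_sub_le ht (hT s hs) f

lemma DefectControlled.mul_self (hT : ∀ s ∈ T, s⁻¹ ∈ T) (hne : T.Nonempty) {g : G}
    (hg : g ∈ Subgroup.closure (T : Set G)) : DefectControlled T (g * g) := by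
  have key : (DefectControlled T g ∧ ∀ s ∈ T, ∀ t ∈ T, DefectControlled T (s * g * t)) ∨
      (∀ s ∈ T, DefectControlled T (s * g) ∧ DefectControlled T (g * s)) := by
    have step : ∀ x, ∀ y ∈ T,
        ((DefectControlled T x ∧ ∀ s ∈ T, ∀ t ∈ T, DefectControlled T (s * x * t)) ∨
        (∀ s ∈ T, DefectControlled T (s * x) ∧ DefectControlled T (x * s))) →
        ((DefectControlled T (x * y) ∧ ∀ s ∈ T, ∀ t ∈ T, DefectControlled T (s * (x * y) * t)) ∨
        (∀ s ∈ T, DefectControlled T (s * (x * y)) ∧ DefectControlled T (x * y * s))) := by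
      rintro x y hy (⟨h1, h2⟩ | h)
      · refine Or.inr fun s hs => ⟨?_, ?_⟩
        · rw [← mul_assoc]; exact h2 s hs y hy
        · rw [mul_assoc]; exact h1.mul (.mul_of_mem hT hy hs)
      · refine Or.inl ⟨(h y hy).2, fun s hs t ht => ?_⟩
        rw [← mul_assoc, mul_assoc]
        exact (h s hs).1.mul (.mul_of_mem hT hy ht)
    induction hg using Subgroup.closure_induction_right with
    | one => exact Or.inl ⟨.one, fun s hs t ht => by rw [mul_one]; exact .mul_of_mem hT hs ht⟩
    | mul_right x _ y hy ih => exact step x y hy ih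
    | mul_inv_cancel x _ y hy ih => exact step x y⁻¹ (hT y hy) ih
  rcases key with ⟨h, -⟩ | h
  · exact h.mul h
  · obtain ⟨s, hs⟩ := hne
    have : g * g = (g * s) * (s⁻¹ * g) := by group
    rw [this]
    exact (h s hs).2.mul (h _ (hT s hs)).1

lemma norm_sq_le_of_pingpong {X : Type} [MulAction G X] {N : ℕ} (hN1 : (1 : ℝ) ≤ N) {t : G}
    {R R' : Set X} (hcov : ∀ x, x ∈ R ∨ t • x ∈ R') (f : lp (fun _ : X => ℝ) 2) :
    ‖f‖ ^ 2 ≤ ∑' x, R.indicator (fun x => f x ^ 2) x +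
      ((1 + 1 / (N : ℝ)) * ∑' x, R'.indicator (fun x => f x ^ 2) x +
        (1 + N) * ‖ellTwoShift t f - f‖ ^ 2) := by
  have hs := summable_sq f
  have hs1 := hs.indicator (R)
  have hs2 := hs.indicator (R')
  have hs3 := summable_sq (ellTwoShift (t) f - f)
  have hs4 := (summable_sq (ellTwoShift (t) f)).indicator (R')
  have hs5 : Summable fun x => (R').indicator (fun x => ellTwoShift (t) f x ^ 2)
      (t • x) := (MulAction.toPerm (t) : Equiv.Perm X).summable_iff.2 hs4
  have e1 : ‖f‖ ^ 2 ≤ ∑' x, (R).indicator (fun x => f x ^ 2) x +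
      ∑' x, (R').indicator (fun x => ellTwoShift (t) f x ^ 2) (t • x) := by
    rw [norm_sq_eq_tsum_sq, ← hs1.tsum_add hs5]
    refine hs.tsum_le_tsum (fun x => ?_) (hs1.add hs5)
    have n1 : 0 ≤ (R).indicator (fun x => f x ^ 2) x :=
      Set.indicator_nonneg (fun _ _ => sq_nonneg _) _
    have n2 : 0 ≤ (R').indicator (fun x => ellTwoShift (t) f x ^ 2) (t • x) :=
      Set.indicator_nonneg (fun _ _ => sq_nonneg _) _
    rcases hcov x with h | h
    · rw [Set.indicator_of_mem h]; linarith
    · rw [Set.indicator_of_mem h, ellTwoShift_apply, inv_smul_smul]; linarith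
  have e2 : ∑' x, (R').indicator (fun x => ellTwoShift (t) f x ^ 2) (t • x) =
      ∑' x, (R').indicator (fun x => ellTwoShift (t) f x ^ 2) x :=
    (MulAction.toPerm (t) : Equiv.Perm X).tsum_eq
      (fun x => (R').indicator (fun x => ellTwoShift (t) f x ^ 2) x)
  have e3 : ∑' x, (R').indicator (fun x => ellTwoShift (t) f x ^ 2) x ≤
      (1 + 1 / (N : ℝ)) * ∑' x, (R').indicator (fun x => f x ^ 2) x +
      (1 + N) * ‖ellTwoShift (t) f - f‖ ^ 2 := by
    rw [norm_sq_eq_tsum_sq, ← tsum_mul_left, ← tsum_mul_left,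
      ← (hs2.mul_left _).tsum_add (hs3.mul_left _)]
    refine hs4.tsum_le_tsum (fun x => ?_) ((hs2.mul_left _).add (hs3.mul_left _))
    by_cases h : x ∈ R'
    · rw [Set.indicator_of_mem h, Set.indicator_of_mem h]
      rw [lp.coeFn_sub, Pi.sub_apply]
      generalize ellTwoShift (t) f x = p
      generalize f x = q
      have : (1 + 1 / (N : ℝ)) * q ^ 2 + (1 + N) * (p - q) ^ 2 - p ^ 2 =
          (q - N * (p - q)) ^ 2 / N := by
        field_simp
        ring
      have h0 : 0 ≤ (q - N * (p - q)) ^ 2 / (N : ℝ) := by positivity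
      linarith
    · rw [Set.indicator_of_notMem h, Set.indicator_of_notMem h]
      positivity
  linarith

open Classical in
lemma sum_tsum_indicator_le {X : Type} {N : ℕ} {R R' : Fin N → Set X}
    (hcount : ∀ x, (Finset.univ.filter fun j => x ∈ R j).card +
        (Finset.univ.filter fun j => x ∈ R' j).card < N) (f : lp (fun _ : X => ℝ) 2) :
    ∑ j, (∑' x, (R j).indicator (fun x => f x ^ 2) x +
        ∑' x, (R' j).indicator (fun x => f x ^ 2) x) ≤ (N - 1) * ‖f‖ ^ 2 := by
  have hs := summable_sq f
  have hs12 : ∀ j ∈ Finset.univ, Summable fun x => (R j).indicator (fun x => f x ^ 2) x +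
      (R' j).indicator (fun x => f x ^ 2) x :=
    fun j _ => (hs.indicator (R j)).add (hs.indicator (R' j))
  have e1 : ∀ j, ∑' x, (R j).indicator (fun x => f x ^ 2) x +
    ∑' x, (R' j).indicator (fun x => f x ^ 2) x =
    ∑' x, ((R j).indicator (fun x => f x ^ 2) x + (R' j).indicator (fun x => f x ^ 2) x) :=
    fun j => ((hs.indicator (R j)).tsum_add (hs.indicator (R' j))).symm
  simp_rw [e1]
  rw [← Summable.tsum_finsetSum hs12, norm_sq_eq_tsum_sq, ← tsum_mul_left]
  refine (summable_sum hs12).tsum_le_tsum (fun x => ?_) (hs.mul_left _)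
  have hx := hcount x
  have hx' : ((Finset.univ.filter fun j => x ∈ R j).card : ℝ) +
    (Finset.univ.filter fun j => x ∈ R' j).card ≤ N - 1 := by
    have : ((Finset.univ.filter fun j => x ∈ R j).card +
      (Finset.univ.filter fun j => x ∈ R' j).card + 1 : ℝ) ≤ N := by exact_mod_cast hx
    linarith
  simp only [Set.indicator_apply]
  rw [Finset.sum_add_distrib, ← Finset.sum_filter, ← Finset.sum_filter, Finset.sum_const,
    Finset.sum_const, nsmul_eq_mul, nsmul_eq_mul, ← add_mul]
  exact mul_le_mul_of_nonneg_right hx' (sq_nonneg _)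

open Classical in
/-- A ping-pong criterion for a spectral gap, uniform over all `G`-sets. -/
lemma exists_walkExp_return_le {N : ℕ} {t : Fin N → G}
    (hne : T.Nonempty) (ht : ∀ j, DefectControlled T (t j)) :
    ∃ r : ℝ, 0 ≤ r ∧ r < 1 ∧ ∀ (X : Type) [MulAction G X] (R R' : Fin N → Set X),
      (∀ j x, x ∈ R j ∨ t j • x ∈ R' j) →
      (∀ x, (Finset.univ.filter fun j => x ∈ R j).card +
        (Finset.univ.filter fun j => x ∈ R' j).card < N) →
      ∀ (x : X) (n : ℕ), walkExp T n (fun g => if g • x = x then 1 else 0) ≤ r ^ n := by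
  choose K hK0 hK using ht
  rcases Nat.eq_zero_or_pos N with rfl | hN
  · exact ⟨0, le_rfl, one_pos, fun X _ R R' _ h x => absurd (h x) (by simp)⟩
  set A : ℝ := N * (N + 1) * (∑ j, K j ^ 2 + 1) with hA
  have hN1 : (1 : ℝ) ≤ N := by exact_mod_cast hN
  have hsum : 0 ≤ ∑ j, K j ^ 2 := by positivity
  have hA1 : 1 ≤ A := by
    rw [hA]
    have h1 : (1 : ℝ) ≤ N * (N + 1) := by nlinarith
    nlinarith
  have hApos : 0 < A := by linarith
  refine ⟨√(1 - A⁻¹), by positivity, ?_, fun X _ R R' hcov hcount => ?_⟩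
  · rw [Real.sqrt_lt' one_pos]
    have : 0 < A⁻¹ := by positivity
    linarith
  have hAinv : A⁻¹ ≤ 1 := inv_le_one_of_one_le₀ hA1
  refine walkExp_return_le (by positivity) fun f => ?_
  have main : ‖f‖ ^ 2 ≤ A * (‖f‖ ^ 2 - ‖ellTwoMean T f‖ ^ 2) := by
    have hD := norm_ellTwoMean_le hne f
    have hj : ∀ j, ‖ellTwoShift (t j) f - f‖ ^ 2 ≤
        K j ^ 2 * (‖f‖ ^ 2 - ‖ellTwoMean T f‖ ^ 2) := by
      intro j
      have := pow_le_pow_left₀ (norm_nonneg _) (hK j X f) 2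
      rwa [mul_pow, Real.sq_sqrt hD] at this
    have hcover := fun j => norm_sq_le_of_pingpong hN1 (hcov j) f
    have hcount' := sum_tsum_indicator_le hcount f
    have total : (N : ℝ) * ‖f‖ ^ 2 ≤ (1 + 1 / (N : ℝ)) * ((N - 1) * ‖f‖ ^ 2) +
        (1 + N) * ((∑ j, K j ^ 2) * (‖f‖ ^ 2 - ‖ellTwoMean T f‖ ^ 2)) := by
      calc (N : ℝ) * ‖f‖ ^ 2 = ∑ _j : Fin N, ‖f‖ ^ 2 := by simp
        _ ≤ ∑ j : Fin N, ((1 + 1 / (N : ℝ)) * (∑' x, (R j).indicator (fun x => f x ^ 2) x +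
              ∑' x, (R' j).indicator (fun x => f x ^ 2) x) +
              (1 + N) * (K j ^ 2 * (‖f‖ ^ 2 - ‖ellTwoMean T f‖ ^ 2))) := by
            refine Finset.sum_le_sum fun j _ => ?_
            have h1 := hcover j
            have h2 := hj j
            have h3 : 0 ≤ ∑' x, (R j).indicator (fun x => f x ^ 2) x :=
              tsum_nonneg fun x => Set.indicator_nonneg (fun _ _ => sq_nonneg _) _
            have h4 : 0 ≤ 1 / (N : ℝ) * ∑' x, (R j).indicator (fun x => f x ^ 2) x := by positivity
            have h5 : (1 + N : ℝ) * ‖ellTwoShift (t j) f - f‖ ^ 2 ≤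
              (1 + N) * (K j ^ 2 * (‖f‖ ^ 2 - ‖ellTwoMean T f‖ ^ 2)) :=
              mul_le_mul_of_nonneg_left h2 (by positivity)
            rw [mul_add]
            linarith
        _ ≤ _ := by
            rw [Finset.sum_add_distrib, ← Finset.mul_sum, ← Finset.mul_sum, ← Finset.sum_mul]
            gcongr
    have e : (1 + 1 / (N : ℝ)) * ((N - 1) * ‖f‖ ^ 2) = (N - 1 / N) * ‖f‖ ^ 2 := by
      have hN0 : (N : ℝ) ≠ 0 := by linarith
      have : (1 + 1 / (N : ℝ)) * (N - 1) = N - 1 / N := by field_simp; ring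
      rw [← mul_assoc, this]
    rw [e] at total
    have t2 : 1 / (N : ℝ) * ‖f‖ ^ 2 ≤
        (1 + N) * ((∑ j, K j ^ 2) * (‖f‖ ^ 2 - ‖ellTwoMean T f‖ ^ 2)) := by linarith
    have t3 : ‖f‖ ^ 2 ≤
        N * ((1 + N) * ((∑ j, K j ^ 2) * (‖f‖ ^ 2 - ‖ellTwoMean T f‖ ^ 2))) := by
      rw [one_div, inv_mul_le_iff₀ (by linarith)] at t2
      exact t2
    have t4 : 0 ≤ (N : ℝ) * (N + 1) * (‖f‖ ^ 2 - ‖ellTwoMean T f‖ ^ 2) := by positivity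
    rw [hA]
    linarith
  have h2 : ‖ellTwoMean T f‖ ^ 2 ≤ (1 - A⁻¹) * ‖f‖ ^ 2 := by
    have : A⁻¹ * ‖f‖ ^ 2 ≤ ‖f‖ ^ 2 - ‖ellTwoMean T f‖ ^ 2 := by
      rwa [inv_mul_le_iff₀ hApos]
    linarith
  rw [← Real.sqrt_sq (norm_nonneg (ellTwoMean T f)), ← Real.sqrt_sq (norm_nonneg f),
    ← Real.sqrt_mul (by linarith)]
  exact Real.sqrt_le_sqrt (by simpa using h2)

end defect

/-- The complex matrix of a component of an element of `SL₂(ℤ)³`. -/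
noncomputable def compC (g : GammaSL) (i : Fin 3) : Matrix (Fin 2) (Fin 2) ℂ :=
  Matrix.of fun a b => (entryZ g (i, a, b) : ℂ)

lemma compC_mul (g h : GammaSL) (i : Fin 3) : compC (g * h) i = compC g i * compC h i := by
  ext a b
  have key : ∀ m n : SL2Z, (((m * n : SL2Z) a b : ℤ) : ℂ) =
      (m a 0 : ℤ) * (n 0 b : ℤ) + (m a 1 : ℤ) * (n 1 b : ℤ) := by
    intro m n
    rw [Matrix.SpecialLinearGroup.coe_mul, Matrix.mul_apply, Fin.sum_univ_two]
    push_cast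
    rfl
  rw [Matrix.mul_apply, Fin.sum_univ_two]
  fin_cases i
  · exact key g.1 h.1
  · exact key g.2.1 h.2.1
  · exact key g.2.2 h.2.2

lemma compC_one (i : Fin 3) : compC 1 i = 1 := by
  ext a b
  have key : (((1 : SL2Z) a b : ℤ) : ℂ) = (1 : Matrix (Fin 2) (Fin 2) ℂ) a b := by
    rw [Matrix.SpecialLinearGroup.coe_one, Matrix.one_apply, Matrix.one_apply]
    split_ifs <;> simp
  fin_cases i <;> exact key

lemma det_compC (g : GammaSL) (i : Fin 3) : (compC g i).det = 1 := by
  have h : ∀ m : SL2Z, ((m 0 0 : ℤ) : ℂ) * (m 1 1 : ℤ) - (m 0 1 : ℤ) * (m 1 0 : ℤ) = 1 := by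
    intro m
    have := m.det_coe
    rw [Matrix.det_fin_two] at this
    exact_mod_cast this
  rw [Matrix.det_fin_two]
  fin_cases i
  · exact h g.1
  · exact h g.2.1
  · exact h g.2.2

lemma compC_inv_mul (g : GammaSL) (i : Fin 3) : compC g⁻¹ i * compC g i = 1 := by
  rw [← compC_mul, inv_mul_cancel, compC_one]

lemma compC_mul_inv (g : GammaSL) (i : Fin 3) : compC g i * compC g⁻¹ i = 1 := by
  rw [← compC_mul, mul_inv_cancel, compC_one]

/-- Polynomial functions on triples of complex `2 × 2` matrices. -/
noncomputable def polyFun : Subalgebra ℂ ((Fin 3 → Matrix (Fin 2) (Fin 2) ℂ) → ℂ) :=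
  (MvPolynomial.aeval (R := ℂ)
    (fun (x : Fin 3 × Fin 2 × Fin 2) (m : Fin 3 → Matrix (Fin 2) (Fin 2) ℂ) =>
      m x.1 x.2.1 x.2.2)).range

lemma mem_polyFun {F : (Fin 3 → Matrix (Fin 2) (Fin 2) ℂ) → ℂ} :
    F ∈ polyFun ↔ ∃ P : MvPolynomial (Fin 3 × Fin 2 × Fin 2) ℂ,
      ∀ m, F m = MvPolynomial.eval (fun x => m x.1 x.2.1 x.2.2) P := by
  have key : ∀ (P : MvPolynomial (Fin 3 × Fin 2 × Fin 2) ℂ) m, MvPolynomial.aeval (R := ℂ)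
    (fun (x : Fin 3 × Fin 2 × Fin 2) (m : Fin 3 → Matrix (Fin 2) (Fin 2) ℂ) =>
      m x.1 x.2.1 x.2.2) P m = MvPolynomial.eval (fun x => m x.1 x.2.1 x.2.2) P := by
    intro P m
    have := MvPolynomial.comp_aeval_apply (R := ℂ)
      (fun (x : Fin 3 × Fin 2 × Fin 2) (m : Fin 3 → Matrix (Fin 2) (Fin 2) ℂ) =>
        m x.1 x.2.1 x.2.2) (Pi.evalAlgHom ℂ _ m) P
    simp only [Pi.evalAlgHom_apply] at this
    rw [this, MvPolynomial.aeval_eq_eval]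
  constructor
  · rintro ⟨P, rfl⟩
    exact ⟨P, fun m => key P m⟩
  · rintro ⟨P, hP⟩
    exact ⟨P, funext fun m => (key P m).trans (hP m).symm⟩

lemma entry_mem_polyFun (i : Fin 3) (a b : Fin 2) : (fun m => m i a b) ∈ polyFun :=
  mem_polyFun.2 ⟨MvPolynomial.X (i, a, b), fun m => by simp⟩

lemma const_mem_polyFun (c : ℂ) : (fun _ => c) ∈ polyFun :=
  mem_polyFun.2 ⟨MvPolynomial.C c, fun m => by simp⟩

lemma det_mem_polyFun (i : Fin 3) : (fun m => (m i).det) ∈ polyFun := by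
  simp_rw [Matrix.det_fin_two]
  exact sub_mem (mul_mem (entry_mem_polyFun i 0 0) (entry_mem_polyFun i 1 1))
    (mul_mem (entry_mem_polyFun i 0 1) (entry_mem_polyFun i 1 0))

/-- Zariski density with complex coefficients. -/
lemma ZariskiDense.eq_zero {H : Subgroup GammaSL} (hH : ZariskiDense H)
    {F : (Fin 3 → Matrix (Fin 2) (Fin 2) ℂ) → ℂ} (hF : F ∈ polyFun)
    (h0 : ∀ g ∈ H, F (compC g) = 0) (m : Fin 3 → Matrix (Fin 2) (Fin 2) ℂ)
    (hm : ∀ i, (m i).det = 1) : F m = 0 := by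
  obtain ⟨P, hP⟩ := mem_polyFun.1 hF
  set h : GammaC := (⟨m 0, hm 0⟩, ⟨m 1, hm 1⟩, ⟨m 2, hm 2⟩) with hh
  have hent : (fun x : Fin 3 × Fin 2 × Fin 2 => m x.1 x.2.1 x.2.2) = entryC h := by
    funext ⟨i, a, b⟩
    fin_cases i <;> rfl
  have key : ∀ φ : ℂ →ₗ[ℚ] ℚ, ∑ d ∈ P.support,
      (φ (P.coeff d) : ℂ) * ∏ x, entryC h x ^ d x = 0 := by
    intro φ
    have := hH (∑ d ∈ P.support, MvPolynomial.monomial d (φ (P.coeff d))) ?_ h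
    · simpa [MvPolynomial.aeval_monomial, Finsupp.prod_fintype] using this
    · intro g hg
      have h1 := h0 g hg
      rw [hP, MvPolynomial.eval_eq'] at h1
      have h2 := congrArg φ h1
      rw [map_sum, map_zero] at h2
      have h3 : ∀ d : Fin 3 × Fin 2 × Fin 2 →₀ ℕ,
          P.coeff d * ∏ x, (compC g x.1 x.2.1 x.2.2) ^ d x =
            (∏ x, (entryZ g x : ℚ) ^ d x) • P.coeff d := by
        intro d
        rw [Rat.smul_def, mul_comm]
        push_cast
        rfl
      simp_rw [h3, map_smul] at h2
      have h4 := congrArg (fun q : ℚ => (q : ℂ)) h2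
      simp only [smul_eq_mul] at h4
      push_cast at h4
      simp only [map_sum, MvPolynomial.aeval_monomial, Finsupp.prod_fintype, pow_zero,
        implies_true, eq_ratCast]
      rw [← h4]
      exact Finset.sum_congr rfl fun d _ => mul_comm _ _
  rw [hP, hent, MvPolynomial.eval_eq']
  set b := Module.Basis.ofVectorSpace ℚ ℂ
  classical
  set E := P.support.biUnion fun d => (b.repr (P.coeff d)).support
  have hexp : ∀ d ∈ P.support, P.coeff d = ∑ k ∈ E, (b.coord k (P.coeff d) : ℂ) * b k := by
    intro d hd
    conv_lhs => rw [← b.linearCombination_repr (P.coeff d), Finsupp.linearCombination_apply]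
    rw [Finsupp.sum_of_support_subset (s := E) _
      (Finset.subset_biUnion_of_mem (fun d => (b.repr (P.coeff d)).support) hd) _ (by simp)]
    exact Finset.sum_congr rfl fun k _ => by rw [Rat.smul_def]; rfl
  calc _ = ∑ d ∈ P.support, ∑ k ∈ E,
        b k * ((b.coord k (P.coeff d) : ℂ) * ∏ x, entryC h x ^ d x) := by
        refine Finset.sum_congr rfl fun d hd => ?_
        conv_lhs => rw [hexp d hd, Finset.sum_mul]
        exact Finset.sum_congr rfl fun k _ => by ring
    _ = 0 := by
        rw [Finset.sum_comm]
        refine Finset.sum_eq_zero fun k _ => ?_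
        rw [← Finset.mul_sum, key, mul_zero]

/-- Finitely many nonzero multihomogeneous polynomial functions have a common nonvanishing point
in a Zariski-dense subgroup. -/
lemma ZariskiDense.exists_ne_zero {H : Subgroup GammaSL} (hH : ZariskiDense H)
    {ι : Type*} (s : Finset ι) (F : ι → (Fin 3 → Matrix (Fin 2) (Fin 2) ℂ) → ℂ)
    (hF : ∀ k ∈ s, F k ∈ polyFun)
    (hhom : ∀ k ∈ s, ∀ m, ∀ c : Fin 3 → ℂ, (∀ i, c i ≠ 0) → F k m ≠ 0 →
      F k (fun i => c i • m i) ≠ 0)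
    (hne : ∀ k ∈ s, ∃ m, F k m ≠ 0) : ∃ g ∈ H, ∀ k ∈ s, F k (compC g) ≠ 0 := by
  by_contra! hcon
  have hdet : ∀ i, ∃ P : MvPolynomial (Fin 3 × Fin 2 × Fin 2) ℂ, P ≠ 0 ∧
      ∀ m : Fin 3 → Matrix (Fin 2) (Fin 2) ℂ,
        (m i).det = MvPolynomial.eval (fun x => m x.1 x.2.1 x.2.2) P := by
    intro i
    obtain ⟨P, hP⟩ := mem_polyFun.1 (det_mem_polyFun i)
    refine ⟨P, ?_, hP⟩
    rintro rfl
    have := hP (fun _ => 1)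
    simp at this
  choose D hD0 hD using hdet
  have hP : ∀ k, ∃ P : MvPolynomial (Fin 3 × Fin 2 × Fin 2) ℂ, k ∈ s → P ≠ 0 ∧
      ∀ m, F k m = MvPolynomial.eval (fun x => m x.1 x.2.1 x.2.2) P := by
    intro k
    by_cases hk : k ∈ s
    · obtain ⟨P, hP⟩ := mem_polyFun.1 (hF k hk)
      refine ⟨P, fun _ => ⟨?_, hP⟩⟩
      rintro rfl
      obtain ⟨m, hm⟩ := hne k hk
      exact hm (by simp [hP m])
    · exact ⟨0, fun h => absurd h hk⟩
  choose P hP using hP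
  have hprod : (∏ k ∈ s, P k) * ∏ i, D i ≠ 0 :=
    mul_ne_zero (Finset.prod_ne_zero_iff.2 fun k hk => (hP k hk).1)
      (Finset.prod_ne_zero_iff.2 fun i _ => hD0 i)
  have : ∃ z, MvPolynomial.eval z ((∏ k ∈ s, P k) * ∏ i, D i) ≠ 0 := by
    by_contra! h
    exact hprod (MvPolynomial.funext fun z => by rw [h z, map_zero])
  obtain ⟨z, hz⟩ := this
  rw [map_mul, map_prod, map_prod] at hz
  set m : Fin 3 → Matrix (Fin 2) (Fin 2) ℂ := fun i => Matrix.of fun a b => z (i, a, b)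
  have hzm : z = fun x => m x.1 x.2.1 x.2.2 := rfl
  rw [hzm] at hz
  have hm1 : ∀ k ∈ s, F k m ≠ 0 := fun k hk => by
    rw [(hP k hk).2]
    exact Finset.prod_ne_zero_iff.1 (left_ne_zero_of_mul hz) k hk
  have hm2 : ∀ i, (m i).det ≠ 0 := fun i => by
    rw [hD]
    exact Finset.prod_ne_zero_iff.1 (right_ne_zero_of_mul hz) i (Finset.mem_univ i)
  have hsq : ∀ i, ∃ c : ℂ, c ^ 2 = ((m i).det)⁻¹ := fun i =>
    IsAlgClosed.exists_pow_nat_eq _ (by norm_num)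
  choose c hc using hsq
  have hc0 : ∀ i, c i ≠ 0 := fun i h => by
    have := hc i
    rw [h] at this
    exact inv_ne_zero (hm2 i) (by rw [← this]; norm_num)
  have hzero := hH.eq_zero (F := fun m => ∏ k ∈ s, F k m) ?_ ?_ (fun i => c i • m i) ?_
  · exact Finset.prod_ne_zero_iff.2 (fun k hk => hhom k hk m c hc0 (hm1 k hk)) hzero
  · have := Subalgebra.prod_mem polyFun (t := s) (f := F) hF
    convert this using 1
    funext m
    simp
  · intro g hg
    obtain ⟨k, hk, hk0⟩ := hcon g hg
    exact Finset.prod_eq_zero hk hk0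
  · intro i
    rw [Matrix.det_smul, Fintype.card_fin, hc, inv_mul_cancel₀ (hm2 i)]

/-- A Zariski-dense subgroup contains an element which is hyperbolic in every component. -/
lemma ZariskiDense.exists_hyperbolic {H : Subgroup GammaSL} (hH : ZariskiDense H) :
    ∃ g ∈ H, ∀ i, ∃ t : ℤ, 3 ≤ |t| ∧ (compC g i).trace = t := by
  by_contra! hcon
  have hzero := hH.eq_zero
    (F := fun m => ∏ i, ∏ k ∈ Finset.Icc (-2 : ℤ) 2, ((m i).trace - (k : ℂ))) ?_ ?_
    (fun _ => !![3, -1; 1, 0]) (by simp [Matrix.det_fin_two])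
  · rw [Finset.prod_eq_zero_iff] at hzero
    obtain ⟨i, -, h⟩ := hzero
    rw [Finset.prod_eq_zero_iff] at h
    obtain ⟨k, hk, h⟩ := h
    rw [Finset.mem_Icc] at hk
    have h1 : (3 : ℂ) - k = 0 := by simpa [Matrix.trace_fin_two] using h
    have h2 : (3 : ℤ) - k = 0 := by exact_mod_cast h1
    omega
  · have := Subalgebra.prod_mem polyFun (t := Finset.univ)
      (f := fun (i : Fin 3) => ∏ k ∈ Finset.Icc (-2 : ℤ) 2,
        fun (m : Fin 3 → Matrix (Fin 2) (Fin 2) ℂ) => ((m i).trace - (k : ℂ)))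
      (fun i _ => Subalgebra.prod_mem polyFun fun k _ => ?_)
    · convert this using 1
      funext m
      simp only [Finset.prod_apply]
    · simp_rw [Matrix.trace_fin_two]
      exact sub_mem (add_mem (entry_mem_polyFun i 0 0) (entry_mem_polyFun i 1 1))
        (const_mem_polyFun _)
  · intro g hg
    obtain ⟨i, hi⟩ := hcon g hg
    refine Finset.prod_eq_zero (Finset.mem_univ i) ?_
    have htr : (compC g i).trace = ((entryZ g (i, 0, 0) + entryZ g (i, 1, 1) : ℤ) : ℂ) := by
      rw [Matrix.trace_fin_two]; push_cast; rfl
    have hlt : |entryZ g (i, 0, 0) + entryZ g (i, 1, 1)| < 3 := by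
      by_contra! h
      exact hi _ h htr
    rw [abs_lt] at hlt
    refine Finset.prod_eq_zero (i := entryZ g (i, 0, 0) + entryZ g (i, 1, 1))
      (Finset.mem_Icc.2 ⟨by omega, by omega⟩) ?_
    rw [htr, sub_self]

lemma exists_eigenvectors {m : Matrix (Fin 2) (Fin 2) ℂ} (hdet : m.det = 1) {t : ℤ}
    (ht : 3 ≤ |t|) (htr : m.trace = t) :
    ∃ (μ : ℂ) (v v' : Fin 2 → ℂ), 1 < ‖μ‖ ∧ v ≠ 0 ∧ v' ≠ 0 ∧ m *ᵥ v = μ • v ∧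
      m *ᵥ v' = μ⁻¹ • v' := by
  have hev : ∀ ν : ℂ, ν ^ 2 - t * ν + 1 = 0 → ∃ v ≠ 0, m *ᵥ v = ν • v := by
    intro ν hν
    have h : (m - ν • (1 : Matrix (Fin 2) (Fin 2) ℂ)).det = 0 := by
      rw [Matrix.det_fin_two] at hdet ⊢
      rw [Matrix.trace_fin_two] at htr
      simp
      linear_combination hdet + hν - ν * htr
    obtain ⟨v, hv, h⟩ := Matrix.exists_mulVec_eq_zero_iff.2 h
    refine ⟨v, hv, ?_⟩
    rw [Matrix.sub_mulVec, Matrix.smul_mulVec, Matrix.one_mulVec, sub_eq_zero] at h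
    exact h
  have hroot : ∃ ν : ℂ, 1 < ‖ν‖ ∧ ν ^ 2 - t * ν + 1 = 0 := by
    obtain ⟨ν, hν⟩ := IsAlgClosed.exists_pow_nat_eq ((t : ℂ) ^ 2 - 4) (n := 2) (by norm_num)
    have h1 : ((t + ν) / 2) ^ 2 - t * ((t + ν) / 2) + 1 = 0 := by linear_combination hν / 4
    have h2 : ((t - ν) / 2) ^ 2 - t * ((t - ν) / 2) + 1 = 0 := by linear_combination hν / 4
    by_contra! hcon
    have h3 : ‖(t + ν) / 2‖ ≤ 1 := by
      by_contra! h
      exact hcon _ h h1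
    have h4 : ‖(t - ν) / 2‖ ≤ 1 := by
      by_contra! h
      exact hcon _ h h2
    have h5 : ‖(t : ℂ)‖ ≤ 2 := by
      have : (t : ℂ) = (t + ν) / 2 + (t - ν) / 2 := by ring
      rw [this]
      exact (norm_add_le _ _).trans (by linarith)
    rw [Complex.norm_intCast] at h5
    have h6 : (3 : ℝ) ≤ |(t : ℝ)| := by exact_mod_cast ht
    linarith
  obtain ⟨ν, hν1, hν⟩ := hroot
  have hν0 : ν ≠ 0 := by
    rintro rfl
    simp at hν1
    linarith
  obtain ⟨v, hv, hv'⟩ := hev ν hν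
  obtain ⟨w, hw, hw'⟩ := hev ν⁻¹ (by
    have : ν⁻¹ ^ 2 - t * ν⁻¹ + 1 = (ν ^ 2 - t * ν + 1) * ν⁻¹ ^ 2 := by field_simp; ring
    rw [this, hν, zero_mul])
  exact ⟨ν, v, w, hν1, hv, hw, hv', hw'⟩

section general_position
variable {V : Type*} [AddCommGroup V] [Module ℂ V] [FiniteDimensional ℂ V] {I : Type*}

/-- If finitely many nonzero vectors can always be avoided by a functional of the family `f`, then
a family of functionals in general position can be enlarged. -/
lemma finrank_iInf_ker_update (f : I → Module.Dual ℂ V) {n : ℕ} {h : ℕ → I}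
    (hh : ∀ J ⊆ Finset.range n, (⨅ j ∈ J, LinearMap.ker (f (h j))) ≠ ⊥ →
      Module.finrank ℂ ↥(⨅ j ∈ J, LinearMap.ker (f (h j))) + J.card ≤ Module.finrank ℂ V) {i : I}
    (hi : ∀ J ⊆ Finset.range n, (⨅ j ∈ J, LinearMap.ker (f (h j))) ≠ ⊥ →
      ∃ w ∈ ⨅ j ∈ J, LinearMap.ker (f (h j)), f i w ≠ 0) :
    ∀ J ⊆ Finset.range (n + 1),
      (⨅ j ∈ J, LinearMap.ker (f (Function.update h n i j))) ≠ ⊥ →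
      Module.finrank ℂ ↥(⨅ j ∈ J, LinearMap.ker (f (Function.update h n i j))) + J.card ≤
        Module.finrank ℂ V := by
  intro J hJ
  have hsame : ∀ J' ⊆ Finset.range n, (⨅ j ∈ J', LinearMap.ker (f (Function.update h n i j))) =
      ⨅ j ∈ J', LinearMap.ker (f (h j)) := by
    intro J' hJ'
    refine iInf_congr fun j => iInf_congr fun hj => ?_
    have : j ≠ n := (Finset.mem_range.1 (hJ' hj)).ne
    rw [Function.update_of_ne this]
  by_cases hn : n ∈ J
  · have hsub : J.erase n ⊆ Finset.range n := by
      intro j hj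
      have h1 := Finset.mem_range.1 (hJ (Finset.mem_of_mem_erase hj))
      have h2 := Finset.ne_of_mem_erase hj
      exact Finset.mem_range.2 (by omega)
    have hinf : (⨅ j ∈ J, LinearMap.ker (f (Function.update h n i j))) =
        LinearMap.ker (f i) ⊓ ⨅ j ∈ J.erase n, LinearMap.ker (f (h j)) := by
      rw [← hsame _ hsub, ← Finset.insert_erase hn, Finset.iInf_insert, Finset.insert_erase hn,
        Function.update_self]
    rw [hinf]
    intro hne
    have hne' : (⨅ j ∈ J.erase n, LinearMap.ker (f (h j))) ≠ ⊥ := fun h0 => hne (by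
      rw [h0, inf_bot_eq])
    have h1 := hh _ hsub hne'
    obtain ⟨w, hw, hw0⟩ := hi _ hsub hne'
    have hlt : LinearMap.ker (f i) ⊓ (⨅ j ∈ J.erase n, LinearMap.ker (f (h j))) <
        ⨅ j ∈ J.erase n, LinearMap.ker (f (h j)) := by
      refine lt_of_le_of_ne inf_le_right fun heq => hw0 ?_
      rw [← heq] at hw
      exact hw.1
    have h2 := Submodule.finrank_lt_finrank_of_lt hlt
    have h3 := Finset.card_erase_add_one hn
    omega
  · have hsub : J ⊆ Finset.range n := by
      intro j hj
      have h1 := Finset.mem_range.1 (hJ hj)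
      have h2 : j ≠ n := fun h => hn (h ▸ hj)
      exact Finset.mem_range.2 (by omega)
    rw [hsame _ hsub]
    exact hh _ hsub

open Classical in
lemma exists_general_position (f f' : I → Module.Dual ℂ V)
    (hZ : ∀ F : Finset V, (∀ w ∈ F, w ≠ 0) → ∃ i, ∀ w ∈ F, f i w ≠ 0 ∧ f' i w ≠ 0) :
    ∃ (N : ℕ) (h : Fin N → I), ∀ w ≠ 0, (Finset.univ.filter fun j => f (h j) w = 0).card +
      (Finset.univ.filter fun j => f' (h j) w = 0).card < N := by
  have hpos : ∀ n : ℕ, ∃ h : ℕ → I,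
      (∀ J ⊆ Finset.range n, (⨅ j ∈ J, LinearMap.ker (f (h j))) ≠ ⊥ →
        Module.finrank ℂ ↥(⨅ j ∈ J, LinearMap.ker (f (h j))) + J.card ≤ Module.finrank ℂ V) ∧
      (∀ J ⊆ Finset.range n, (⨅ j ∈ J, LinearMap.ker (f' (h j))) ≠ ⊥ →
        Module.finrank ℂ ↥(⨅ j ∈ J, LinearMap.ker (f' (h j))) + J.card ≤ Module.finrank ℂ V) := by
    intro n
    induction n with
    | zero =>
      obtain ⟨i, -⟩ := hZ ∅ (by simp)
      refine ⟨fun _ => i, fun J hJ _ => ?_, fun J hJ _ => ?_⟩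
      all_goals
        rw [Finset.range_zero, Finset.subset_empty] at hJ
        subst hJ
        rw [Finset.card_empty, add_zero]
        exact Submodule.finrank_le _
    | succ n ih =>
      obtain ⟨h, h1, h2⟩ := ih
      have hw : ∀ (g : I → Module.Dual ℂ V) (J : Finset ℕ), ∃ w,
          (⨅ j ∈ J, LinearMap.ker (g (h j))) ≠ ⊥ →
            w ∈ (⨅ j ∈ J, LinearMap.ker (g (h j))) ∧ w ≠ 0 := by
        intro g J
        by_cases hb : (⨅ j ∈ J, LinearMap.ker (g (h j))) = ⊥
        · exact ⟨0, fun h => absurd hb h⟩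
        · obtain ⟨w, hw, hw0⟩ := Submodule.exists_mem_ne_zero_of_ne_bot hb
          exact ⟨w, fun _ => ⟨hw, hw0⟩⟩
      choose w hw using hw
      obtain ⟨i, hi⟩ := hZ ((((Finset.range n).powerset.image (w f)) ∪
        ((Finset.range n).powerset.image (w f'))).filter fun w => w ≠ 0) (by simp)
      refine ⟨Function.update h n i, finrank_iInf_ker_update f h1 fun J hJ hb => ?_,
        finrank_iInf_ker_update f' h2 fun J hJ hb => ?_⟩
      · refine ⟨w f J, (hw f J hb).1, (hi _ ?_).1⟩
        exact Finset.mem_filter.2 ⟨Finset.mem_union_left _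
          (Finset.mem_image_of_mem _ (Finset.mem_powerset.2 hJ)), (hw f J hb).2⟩
      · refine ⟨w f' J, (hw f' J hb).1, (hi _ ?_).2⟩
        exact Finset.mem_filter.2 ⟨Finset.mem_union_right _
          (Finset.mem_image_of_mem _ (Finset.mem_powerset.2 hJ)), (hw f' J hb).2⟩
  set d := Module.finrank ℂ V
  obtain ⟨h, h1, h2⟩ := hpos (2 * d - 1)
  refine ⟨2 * d - 1, fun j => h j, fun w hw => ?_⟩
  beta_reduce
  have hbound : ∀ g : I → Module.Dual ℂ V,
      (∀ J ⊆ Finset.range (2 * d - 1), (⨅ j ∈ J, LinearMap.ker (g (h j))) ≠ ⊥ →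
        Module.finrank ℂ ↥(⨅ j ∈ J, LinearMap.ker (g (h j))) + J.card ≤ d) →
      (Finset.univ.filter fun j : Fin (2 * d - 1) => g (h j) w = 0).card + 1 ≤ d := by
    intro g hg
    set J := (Finset.univ.filter fun j : Fin (2 * d - 1) => g (h j) w = 0).map Fin.valEmbedding
    have hmem : w ∈ ⨅ j ∈ J, LinearMap.ker (g (h j)) := by
      simp only [Submodule.mem_iInf, LinearMap.mem_ker]
      intro j hj
      obtain ⟨k, hk, rfl⟩ := Finset.mem_map.1 hj
      exact (Finset.mem_filter.1 hk).2
    have hb : (⨅ j ∈ J, LinearMap.ker (g (h j))) ≠ ⊥ := fun h0 => hw (by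
      rwa [h0, Submodule.mem_bot] at hmem)
    have h3 := hg J (fun j hj => by
      obtain ⟨k, hk, rfl⟩ := Finset.mem_map.1 hj
      exact Finset.mem_range.2 k.2) hb
    rw [Finset.card_map] at h3
    have h4 := Submodule.one_le_finrank_iff.2 hb
    omega
  have b1 := hbound f h1
  have b2 := hbound f' h2
  omega

end general_position

section pingpong
variable {V : Type*} [AddCommGroup V] [Module ℂ V]

lemma exists_norm_le_mul (f : Module.Dual ℂ V) {d : ℕ} (e : V ≃ₗ[ℂ] (Fin d → ℂ)) :
    ∃ C : ℝ, ∀ w, ‖f w‖ ≤ C * ‖e w‖ := by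
  refine ⟨‖LinearMap.toContinuousLinearMap (f ∘ₗ e.symm.toLinearMap)‖, fun w => ?_⟩
  have := (LinearMap.toContinuousLinearMap (f ∘ₗ e.symm.toLinearMap)).le_opNorm (e w)
  simpa using this

open Classical in
/-- General position of functionals persists for approximate zeros. -/
lemma exists_quantitative_general_position {N : ℕ} {f f' : Fin N → Module.Dual ℂ V}
    (hgen : ∀ w ≠ 0, (Finset.univ.filter fun j => f j w = 0).card +
      (Finset.univ.filter fun j => f' j w = 0).card < N) {d : ℕ} (e : V ≃ₗ[ℂ] (Fin d → ℂ)) :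
    ∃ ε : ℝ, 0 < ε ∧ ∀ w ≠ 0, (Finset.univ.filter fun j => ‖f j w‖ ≤ ε * ‖e w‖).card +
      (Finset.univ.filter fun j => ‖f' j w‖ ≤ ε * ‖e w‖).card < N := by
  have hAB : ∀ p : Finset (Fin N) × Finset (Fin N), ∀ᶠ ε : ℝ in nhdsWithin 0 (Set.Ioi 0),
      N ≤ p.1.card + p.2.card → ∀ w ≠ 0, ¬ ((∀ j ∈ p.1, ‖f j w‖ ≤ ε * ‖e w‖) ∧
        ∀ j ∈ p.2, ‖f' j w‖ ≤ ε * ‖e w‖) := by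
    rintro ⟨A, B⟩
    by_cases hcard : N ≤ A.card + B.card
    swap
    · exact Filter.Eventually.of_forall fun _ h => absurd h hcard
    set F : (Fin d → ℂ) → ℝ := fun z => ∑ j ∈ A, ‖f j (e.symm z)‖ + ∑ j ∈ B, ‖f' j (e.symm z)‖
    have hcont : Continuous F := by
      have h1 : ∀ g : Module.Dual ℂ V, Continuous fun z => g (e.symm z) := fun g =>
        (g ∘ₗ e.symm.toLinearMap).continuous_of_finiteDimensional
      exact (continuous_finsetSum _ fun j _ => (h1 _).norm).add
        (continuous_finsetSum _ fun j _ => (h1 _).norm)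
    have hpos : ∀ z ≠ 0, 0 < F z := by
      intro z hz
      have hw : e.symm z ≠ 0 := by simpa using hz
      refine lt_of_le_of_ne (by positivity) fun h0 => ?_
      have h1 := (add_eq_zero_iff_of_nonneg (by positivity) (by positivity)).1 h0.symm
      have h2 := (Finset.sum_eq_zero_iff_of_nonneg fun _ _ => norm_nonneg _).1 h1.1
      have h3 := (Finset.sum_eq_zero_iff_of_nonneg fun _ _ => norm_nonneg _).1 h1.2
      have h4 : A.card ≤ (Finset.univ.filter fun j => f j (e.symm z) = 0).card :=
        Finset.card_le_card fun j hj => by simpa using h2 j hj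
      have h5 : B.card ≤ (Finset.univ.filter fun j => f' j (e.symm z) = 0).card :=
        Finset.card_le_card fun j hj => by simpa using h3 j hj
      have := hgen _ hw
      omega
    have hδ : ∃ δ : ℝ, 0 < δ ∧ ∀ z, ‖z‖ = 1 → δ ≤ F z := by
      rcases (Metric.sphere (0 : Fin d → ℂ) 1).eq_empty_or_nonempty with h0 | hne
      · refine ⟨1, one_pos, fun z hz => ?_⟩
        have : z ∈ Metric.sphere (0 : Fin d → ℂ) 1 := by simpa using hz
        rw [h0] at this
        exact absurd this (Set.notMem_empty z)
      · obtain ⟨z₀, hz₀, hmin⟩ := (isCompact_sphere (0 : Fin d → ℂ) 1).exists_isMinOn hne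
          hcont.continuousOn
        refine ⟨F z₀, hpos z₀ (by rintro rfl; simp at hz₀), fun z hz => hmin (by simpa using hz)⟩
    obtain ⟨δ, hδ, hF⟩ := hδ
    have hev : ∀ᶠ ε : ℝ in nhdsWithin 0 (Set.Ioi 0), ((A.card + B.card : ℕ) : ℝ) * ε < δ := by
      have : Filter.Tendsto (fun ε : ℝ => ((A.card + B.card : ℕ) : ℝ) * ε)
          (nhdsWithin 0 (Set.Ioi 0)) (nhds (((A.card + B.card : ℕ) : ℝ) * 0)) :=
        (Continuous.tendsto (by fun_prop) 0).mono_left nhdsWithin_le_nhds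
      rw [mul_zero] at this
      exact this.eventually_lt_const hδ
    filter_upwards [hev] with ε hε _ w hw ⟨h1, h2⟩
    have hew : 0 < ‖e w‖ := by simpa using hw
    have hnorm : ‖((‖e w‖ : ℂ)⁻¹ • e w)‖ = 1 := by
      rw [norm_smul, norm_inv, Complex.norm_real, norm_norm, inv_mul_cancel₀ hew.ne']
    have h3 := hF _ hnorm
    have h4 : ∀ g : Module.Dual ℂ V, ‖g w‖ ≤ ε * ‖e w‖ →
        ‖g (e.symm ((‖e w‖ : ℂ)⁻¹ • e w))‖ ≤ ε := by
      intro g hg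
      rw [map_smul, map_smul, LinearEquiv.symm_apply_apply, norm_smul, norm_inv,
        Complex.norm_real, norm_norm, inv_mul_le_iff₀ hew, mul_comm]
      exact hg
    have h5 : F ((‖e w‖ : ℂ)⁻¹ • e w) ≤ A.card * ε + B.card * ε := by
      refine add_le_add ?_ ?_
      · rw [← nsmul_eq_mul]
        exact Finset.sum_le_card_nsmul _ _ _ fun j hj => h4 _ (h1 j hj)
      · rw [← nsmul_eq_mul]
        exact Finset.sum_le_card_nsmul _ _ _ fun j hj => h4 _ (h2 j hj)
    push_cast at hε
    linarith
  obtain ⟨ε, hε, hε0⟩ := ((Filter.eventually_all.2 hAB).and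
    (eventually_mem_nhdsWithin (a := (0 : ℝ)) (s := Set.Ioi 0))).exists
  refine ⟨ε, hε0, fun w hw => ?_⟩
  by_contra! hcon
  exact hε (_, _) hcon w hw ⟨fun j hj => (Finset.mem_filter.1 hj).2,
    fun j hj => (Finset.mem_filter.1 hj).2⟩

variable [FiniteDimensional ℂ V]

open Classical in
/-- Uniform exponential decay of the probability that a random walk fixes a line of a
representation, given proximal elements in general position. -/
lemma exists_walkExp_fix_line_le {G : Type} [Group G] {T : Finset G} (hT : ∀ s ∈ T, s⁻¹ ∈ T)
    (hne : T.Nonempty) (ρ : G →* (V →ₗ[ℂ] V)) {N : ℕ} {τ : Fin N → G}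
    (hτ : ∀ j, τ j ∈ Subgroup.closure (T : Set G)) {f f' : Fin N → Module.Dual ℂ V} {c : ℂ}
    (hc : 1 < ‖c‖) (hf : ∀ j w, f j (ρ (τ j) w) = c * f j w)
    (hf' : ∀ j w, f' j (ρ (τ j) w) = c⁻¹ * f' j w)
    (hgen : ∀ w ≠ 0, (Finset.univ.filter fun j => f j w = 0).card +
      (Finset.univ.filter fun j => f' j w = 0).card < N) :
    ∃ r : ℝ, 0 ≤ r ∧ r < 1 ∧ ∀ w ≠ 0, ∀ n,
      walkExp T n (fun g => if ∃ a : ℂ, ρ g w = a • w then 1 else 0) ≤ r ^ n := by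
  set d := Module.finrank ℂ V
  set e : V ≃ₗ[ℂ] (Fin d → ℂ) := (Module.finBasis ℂ V).equivFun
  obtain ⟨ε, hε, hcount⟩ := exists_quantitative_general_position hgen e
  obtain ⟨C, hC0, hC⟩ : ∃ C : ℝ, 0 < C ∧ ∀ j w, ‖f j w‖ ≤ C * ‖e w‖ ∧ ‖f' j w‖ ≤ C * ‖e w‖ := by
    choose C hC using fun j => exists_norm_le_mul (f j) e
    choose C' hC' using fun j => exists_norm_le_mul (f' j) e
    refine ⟨∑ j, (|C j| + |C' j|) + 1, by positivity, fun j w => ?_⟩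
    have h1 : |C j| + |C' j| ≤ ∑ j, (|C j| + |C' j|) :=
      Finset.single_le_sum (f := fun j => |C j| + |C' j|) (fun _ _ => by positivity)
        (Finset.mem_univ j)
    have h2 := le_abs_self (C j)
    have h3 := le_abs_self (C' j)
    have h4 := abs_nonneg (C j)
    have h5 := abs_nonneg (C' j)
    exact ⟨(hC j w).trans (by gcongr; linarith), (hC' j w).trans (by gcongr; linarith)⟩
  have hinv : ∀ (g : G) w, ρ g⁻¹ (ρ g w) = w := fun g w => by
    rw [← Module.End.mul_apply, ← map_mul, inv_mul_cancel, map_one, Module.End.one_apply]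
  have hρ0 : ∀ (g : G) w, w ≠ 0 → ρ g w ≠ 0 := fun g w hw h0 => hw (by
    rw [← hinv g w, h0, map_zero])
  have hpow : ∀ (g : Module.Dual ℂ V) (x : G) (b : ℂ), (∀ w, g (ρ x w) = b * g w) →
      ∀ (n : ℕ) w, g (ρ (x ^ n) w) = b ^ n * g w := by
    intro g x b h n
    induction n with
    | zero => intro w; simp
    | succ n ih =>
      intro w
      rw [pow_succ, map_mul, Module.End.mul_apply, ih, h]
      ring
  obtain ⟨m, hm⟩ : ∃ m : ℕ, C ^ 2 / ε ^ 2 < ‖c‖ ^ m := pow_unbounded_of_one_lt _ hc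
  have hm2 : C ^ 2 ≤ ε ^ 2 * (‖c‖ ^ (m + m) * ‖c‖ ^ (m + m)) := by
    rw [div_lt_iff₀ (by positivity)] at hm
    have h1 : (1 : ℝ) ≤ ‖c‖ ^ m := one_le_pow₀ hc.le
    have h2 : ‖c‖ ^ m ≤ ‖c‖ ^ (m + m) * ‖c‖ ^ (m + m) := by
      rw [← pow_add]
      exact pow_le_pow_right₀ hc.le (by omega)
    nlinarith [sq_nonneg ε]
  have hstep : ∀ j w, w ≠ 0 → ε * ‖e w‖ < ‖f j w‖ →
      ‖f' j (ρ (τ j ^ (m + m)) w)‖ ≤ ε * ‖e (ρ (τ j ^ (m + m)) w)‖ := by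
    intro j w hw h
    have hew : 0 < ‖e w‖ := by simpa using hw
    have h1 := (hC j (ρ (τ j ^ (m + m)) w)).1
    rw [hpow _ _ _ (hf j), norm_mul, norm_pow] at h1
    rw [hpow _ _ _ (hf' j), norm_mul, norm_pow, norm_inv, inv_pow]
    have h2 := (hC j w).2
    have hL : 0 < ‖c‖ ^ (m + m) := by positivity
    generalize ‖c‖ ^ (m + m) = L at *
    generalize ‖e (ρ (τ j ^ (m + m)) w)‖ = E at *
    rw [inv_mul_le_iff₀ hL]
    have h3 : L * (ε * ‖e w‖) ≤ C * E := (mul_le_mul_of_nonneg_left h.le hL.le).trans h1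
    have h4 : C * (C * ‖e w‖) ≤ C * (L * (ε * E)) := by
      calc C * (C * ‖e w‖) = C ^ 2 * ‖e w‖ := by ring
        _ ≤ ε ^ 2 * (L * L) * ‖e w‖ := by gcongr
        _ = ε * L * (L * (ε * ‖e w‖)) := by ring
        _ ≤ ε * L * (C * E) := by gcongr
        _ = _ := by ring
    exact h2.trans (le_of_mul_le_mul_left h4 hC0)
  obtain ⟨r, hr0, hr1, hr⟩ := exists_walkExp_return_le (t := fun j => τ j ^ (m + m)) hne
    (fun j => by
      show DefectControlled T (τ j ^ (m + m))
      rw [pow_add]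
      exact DefectControlled.mul_self hT hne (pow_mem (hτ j) m))
  refine ⟨r, hr0, hr1, fun w hw n => ?_⟩
  let H : Subgroup G :=
    { carrier := {g | ∃ a : ℂ, ρ g w = a • w}
      one_mem' := ⟨1, by simp⟩
      mul_mem' := by
        rintro g h ⟨a, ha⟩ ⟨b, hb⟩
        exact ⟨b * a, by rw [map_mul, Module.End.mul_apply, hb, map_smul, ha, smul_smul]⟩
      inv_mem' := by
        rintro g ⟨a, ha⟩
        have ha0 : a ≠ 0 := by
          rintro rfl
          exact hρ0 g w hw (by rw [ha, zero_smul])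
        refine ⟨a⁻¹, ?_⟩
        have h1 := hinv g w
        rw [ha, map_smul] at h1
        rw [← h1, smul_smul]
        rw [h1, inv_mul_cancel₀ ha0, one_smul] }
  have hH : ∀ g, g ∈ H ↔ ∃ a : ℂ, ρ g w = a • w := fun g => Iff.rfl
  have hmk : ∀ g y : G, g • (y : G ⧸ H) = ((g * y : G) : G ⧸ H) := fun _ _ => rfl
  let R : Module.Dual ℂ V → Set (G ⧸ H) := fun g => {x | ∃ y : G, (y : G ⧸ H) = x ∧
    ‖g (ρ y w)‖ ≤ ε * ‖e (ρ y w)‖}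
  have hR : ∀ (g : Module.Dual ℂ V) (y : G), (y : G ⧸ H) ∈ R g ↔
      ‖g (ρ y w)‖ ≤ ε * ‖e (ρ y w)‖ := by
    intro g y
    refine ⟨?_, fun h => ⟨y, rfl, h⟩⟩
    rintro ⟨z, hz, h⟩
    obtain ⟨a, ha⟩ := (hH _).1 (QuotientGroup.eq.1 hz)
    have h1 : ρ y w = a • ρ z w := by
      rw [← map_smul, ← ha, ← Module.End.mul_apply, ← map_mul, mul_inv_cancel_left]
    rw [h1, map_smul, map_smul, norm_smul, norm_smul]
    calc ‖a‖ * ‖g (ρ z w)‖ ≤ ‖a‖ * (ε * ‖e (ρ z w)‖) := by gcongr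
      _ = _ := by ring
  have := hr (G ⧸ H) (fun j => R (f j)) (fun j => R (f' j)) ?_ ?_ ((1 : G) : G ⧸ H) n
  · refine le_of_eq_of_le ?_ this
    congr 1
    funext g
    have : (g • ((1 : G) : G ⧸ H) = ((1 : G) : G ⧸ H)) ↔ ∃ a : ℂ, ρ g w = a • w := by
      rw [← hH, hmk, mul_one, eq_comm, QuotientGroup.eq]
      simp
    simp only [this]
  · intro j x
    induction x using QuotientGroup.induction_on with
    | H y =>
      by_cases h : (y : G ⧸ H) ∈ R (f j)
      · exact Or.inl h
      · refine Or.inr ?_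
        rw [hR, not_le] at h
        rw [hmk, hR, map_mul, Module.End.mul_apply]
        exact hstep j _ (hρ0 _ _ hw) h
  · intro x
    induction x using QuotientGroup.induction_on with
    | H y =>
      simp only [hR]
      exact hcount _ (hρ0 _ _ hw)

end pingpong

section symSq
variable {R : Type*} [CommRing R]

/-- The symmetric square of a `2 × 2` matrix. -/
def symSq (m : Matrix (Fin 2) (Fin 2) R) : Matrix (Fin 3) (Fin 3) R :=
  !![m 0 0 ^ 2, 2 * m 0 0 * m 0 1, m 0 1 ^ 2;
    m 0 0 * m 1 0, m 0 0 * m 1 1 + m 0 1 * m 1 0, m 0 1 * m 1 1;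
    m 1 0 ^ 2, 2 * m 1 0 * m 1 1, m 1 1 ^ 2]

/-- The degree two Veronese embedding. -/
def veronese (x : Fin 2 → R) : Fin 3 → R := ![x 0 ^ 2, x 0 * x 1, x 1 ^ 2]

/-- The dual Veronese embedding. -/
def coveronese (x : Fin 2 → R) : Fin 3 → R := ![x 1 ^ 2, -2 * x 0 * x 1, x 0 ^ 2]

lemma symSq_mul (m n : Matrix (Fin 2) (Fin 2) R) : symSq (m * n) = symSq m * symSq n := by
  ext i j
  fin_cases i <;> fin_cases j <;>
    simp [symSq, Matrix.mul_apply, Fin.sum_univ_three, Fin.sum_univ_two] <;> ring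

lemma symSq_one : symSq (1 : Matrix (Fin 2) (Fin 2) R) = 1 := by
  ext i j
  fin_cases i <;> fin_cases j <;> simp [symSq]

lemma symSq_mulVec_veronese (m : Matrix (Fin 2) (Fin 2) R) (x : Fin 2 → R) :
    symSq m *ᵥ veronese x = veronese (m *ᵥ x) := by
  funext i
  fin_cases i <;>
    simp [symSq, veronese, Matrix.mulVec, dotProduct, Fin.sum_univ_three, Fin.sum_univ_two] <;> ring

lemma coveronese_mulVec_vecMul {m : Matrix (Fin 2) (Fin 2) R} (hm : m.det = 1) (x : Fin 2 → R) :
    coveronese (m *ᵥ x) ᵥ* symSq m = coveronese x := by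
  rw [Matrix.det_fin_two] at hm
  have h2 : (m 0 0 * m 1 1 - m 0 1 * m 1 0) ^ 2 = 1 := by rw [hm, one_pow]
  funext i
  fin_cases i <;>
    simp [symSq, coveronese, Matrix.mulVec, Matrix.vecMul, dotProduct, Fin.sum_univ_three,
      Fin.sum_univ_two]
  · linear_combination x 1 ^ 2 * h2
  · linear_combination -2 * x 0 * x 1 * h2
  · linear_combination x 0 ^ 2 * h2

lemma veronese_smul (c : R) (x : Fin 2 → R) : veronese (c • x) = c ^ 2 • veronese x := by
  funext i
  fin_cases i <;> simp [veronese] <;> ring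

lemma coveronese_smul (c : R) (x : Fin 2 → R) : coveronese (c • x) = c ^ 2 • coveronese x := by
  funext i
  fin_cases i <;> simp [coveronese] <;> ring

end symSq

/-- The action of `SL₂(ℤ)³` on triples of vectors. -/
noncomputable def actVec (g : GammaSL) (x : Fin 3 → Fin 2 → ℂ) : Fin 3 → Fin 2 → ℂ :=
  fun i => compC g i *ᵥ x i

lemma actVec_mul (g h : GammaSL) (x : Fin 3 → Fin 2 → ℂ) :
    actVec (g * h) x = actVec g (actVec h x) := by
  funext i
  rw [actVec, compC_mul, ← Matrix.mulVec_mulVec]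
  rfl

lemma actVec_one (x : Fin 3 → Fin 2 → ℂ) : actVec 1 x = x := by
  funext i
  simp [actVec, compC_one]

/-- The bihomogeneous form attached to a map between symmetric squares. -/
noncomputable def biForm (i j : Fin 3) :
    Matrix (Fin 3) (Fin 3) ℂ →ₗ[ℂ] ((Fin 3 → Fin 2 → ℂ) → ℂ) where
  toFun Φ x := coveronese (x j) ⬝ᵥ (Φ *ᵥ veronese (x i))
  map_add' Φ Ψ := by
    funext x
    simp [Matrix.add_mulVec, dotProduct_add]
  map_smul' c Φ := by
    funext x
    simp [Matrix.smul_mulVec, dotProduct_smul]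

lemma biForm_apply (i j : Fin 3) (Φ : Matrix (Fin 3) (Fin 3) ℂ) (x : Fin 3 → Fin 2 → ℂ) :
    biForm i j Φ x = coveronese (x j) ⬝ᵥ (Φ *ᵥ veronese (x i)) := rfl

lemma biForm_smul (i j : Fin 3) (Φ : Matrix (Fin 3) (Fin 3) ℂ) (c : Fin 3 → ℂ)
    (x : Fin 3 → Fin 2 → ℂ) :
    biForm i j Φ (fun k => c k • x k) = c j ^ 2 * c i ^ 2 * biForm i j Φ x := by
  simp only [biForm_apply, veronese_smul, coveronese_smul, Matrix.mulVec_smul, dotProduct_smul,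
    smul_dotProduct, smul_eq_mul]
  ring

lemma biForm_actVec_inv (i j : Fin 3) (Φ : Matrix (Fin 3) (Fin 3) ℂ) (g : GammaSL)
    (x : Fin 3 → Fin 2 → ℂ) : biForm i j Φ (actVec g⁻¹ x) =
      biForm i j (symSq (compC g j) * Φ * symSq (compC g⁻¹ i)) x := by
  have h := coveronese_mulVec_vecMul (det_compC g j) (compC g⁻¹ j *ᵥ x j)
  rw [Matrix.mulVec_mulVec, compC_mul_inv, Matrix.one_mulVec] at h
  rw [biForm_apply, biForm_apply, ← Matrix.mulVec_mulVec, symSq_mulVec_veronese,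
    ← Matrix.mulVec_mulVec, Matrix.dotProduct_mulVec _ (symSq (compC g j)), h]
  rfl

/-- The action of `SL₂(ℤ)³` on the space of bihomogeneous forms. -/
noncomputable def biFormRep (i j : Fin 3) :
    GammaSL →* (↥(LinearMap.range (biForm i j)) →ₗ[ℂ] ↥(LinearMap.range (biForm i j))) where
  toFun g := (LinearMap.funLeft ℂ ℂ (actVec g⁻¹)).restrict (by
    rintro _ ⟨Φ, rfl⟩
    exact ⟨symSq (compC g j) * Φ * symSq (compC g⁻¹ i),
      funext fun x => (biForm_actVec_inv i j Φ g x).symm⟩)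
  map_one' := by
    ext P x
    simp [LinearMap.funLeft_apply, LinearMap.restrict_apply, actVec_one]
  map_mul' g h := by
    ext P x
    simp [LinearMap.funLeft_apply, LinearMap.restrict_apply, actVec_mul]

lemma biFormRep_apply (i j : Fin 3) (g : GammaSL) (P : ↥(LinearMap.range (biForm i j)))
    (x : Fin 3 → Fin 2 → ℂ) :
    (biFormRep i j g P : (Fin 3 → Fin 2 → ℂ) → ℂ) x = (P : (Fin 3 → Fin 2 → ℂ) → ℂ)
      (actVec g⁻¹ x) := rfl

/-- Evaluation of bihomogeneous forms at a point. -/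
noncomputable def biFormEval (i j : Fin 3) (x : Fin 3 → Fin 2 → ℂ) :
    Module.Dual ℂ ↥(LinearMap.range (biForm i j)) :=
  LinearMap.proj x ∘ₗ (LinearMap.range (biForm i j)).subtype

lemma biFormEval_apply (i j : Fin 3) (x : Fin 3 → Fin 2 → ℂ)
    (P : ↥(LinearMap.range (biForm i j))) :
    biFormEval i j x P = (P : (Fin 3 → Fin 2 → ℂ) → ℂ) x := rfl

lemma biFormEval_conj (i j : Fin 3) {x : Fin 3 → Fin 2 → ℂ} {b : GammaSL} {c : Fin 3 → ℂ}
    (hb : actVec b⁻¹ x = fun k => c k • x k) (h : GammaSL)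
    (P : ↥(LinearMap.range (biForm i j))) :
    biFormEval i j (actVec h x) (biFormRep i j (h * b * h⁻¹) P) =
      c j ^ 2 * c i ^ 2 * biFormEval i j (actVec h x) P := by
  obtain ⟨_, Φ, rfl⟩ := P
  rw [biFormEval_apply, biFormRep_apply, biFormEval_apply]
  have h1 : actVec (h * b * h⁻¹)⁻¹ (actVec h x) = fun k => c k • actVec h x k := by
    rw [← actVec_mul]
    have : (h * b * h⁻¹)⁻¹ * h = h * b⁻¹ := by group
    rw [this, actVec_mul, hb]
    funext k
    simp [actVec, Matrix.mulVec_smul]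
  rw [h1]
  exact biForm_smul i j Φ c (actVec h x)

lemma biForm_mulVec_mem_polyFun (i j : Fin 3) (Φ : Matrix (Fin 3) (Fin 3) ℂ)
    (v : Fin 3 → Fin 2 → ℂ) : (fun m => biForm i j Φ fun k => m k *ᵥ v k) ∈ polyFun := by
  have h1 : ∀ k a, (fun m : Fin 3 → Matrix (Fin 2) (Fin 2) ℂ => (m k *ᵥ v k) a) ∈ polyFun := by
    intro k a
    simp only [Matrix.mulVec, dotProduct, Fin.sum_univ_two]
    exact add_mem (mul_mem (entry_mem_polyFun k a 0) (const_mem_polyFun _))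
      (mul_mem (entry_mem_polyFun k a 1) (const_mem_polyFun _))
  have h2 : ∀ k a, (fun m : Fin 3 → Matrix (Fin 2) (Fin 2) ℂ => veronese (m k *ᵥ v k) a) ∈
      polyFun := by
    intro k a
    fin_cases a
    · exact pow_mem (h1 k 0) 2
    · exact mul_mem (h1 k 0) (h1 k 1)
    · exact pow_mem (h1 k 1) 2
  have h3 : ∀ k a, (fun m : Fin 3 → Matrix (Fin 2) (Fin 2) ℂ => coveronese (m k *ᵥ v k) a) ∈
      polyFun := by
    intro k a
    fin_cases a
    · exact pow_mem (h1 k 1) 2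
    · exact mul_mem (mul_mem (const_mem_polyFun (-2)) (h1 k 0)) (h1 k 1)
    · exact pow_mem (h1 k 0) 2
  have h4 : ∀ a, (fun m : Fin 3 → Matrix (Fin 2) (Fin 2) ℂ =>
      (Φ *ᵥ veronese (m i *ᵥ v i)) a) ∈ polyFun := by
    intro a
    simp only [Matrix.mulVec, dotProduct, Fin.sum_univ_three]
    exact add_mem (add_mem (mul_mem (const_mem_polyFun _) (h2 i 0))
      (mul_mem (const_mem_polyFun _) (h2 i 1))) (mul_mem (const_mem_polyFun _) (h2 i 2))
  simp only [biForm_apply]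
  have : (fun m : Fin 3 → Matrix (Fin 2) (Fin 2) ℂ =>
      coveronese (m j *ᵥ v j) ⬝ᵥ Φ *ᵥ veronese (m i *ᵥ v i)) = fun m =>
      coveronese (m j *ᵥ v j) 0 * (Φ *ᵥ veronese (m i *ᵥ v i)) 0 +
      coveronese (m j *ᵥ v j) 1 * (Φ *ᵥ veronese (m i *ᵥ v i)) 1 +
      coveronese (m j *ᵥ v j) 2 * (Φ *ᵥ veronese (m i *ᵥ v i)) 2 := by
    funext m
    rw [dotProduct, Fin.sum_univ_three]
  rw [this]
  exact add_mem (add_mem (mul_mem (h3 j 0) (h4 0)) (mul_mem (h3 j 1) (h4 1)))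
    (mul_mem (h3 j 2) (h4 2))

lemma exists_mulVec_eq {v : Fin 2 → ℂ} (hv : v ≠ 0) (x : Fin 2 → ℂ) :
    ∃ m : Matrix (Fin 2) (Fin 2) ℂ, m *ᵥ v = x := by
  obtain ⟨a, ha⟩ := Function.ne_iff.1 hv
  refine ⟨Matrix.vecMulVec x (Pi.single a (v a)⁻¹), ?_⟩
  rw [Matrix.vecMulVec_mulVec]
  simp [inv_mul_cancel₀ ha]

open Classical in
lemma exists_walkExp_biForm_le_aux {T : Finset GammaSL} (hT : ∀ s ∈ T, s⁻¹ ∈ T)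
    (hne : T.Nonempty) (hd : ZariskiDense (Subgroup.closure (T : Set GammaSL))) (i j : Fin 3) :
    ∃ r : ℝ, 0 ≤ r ∧ r < 1 ∧ ∀ Φ, biForm i j Φ ≠ 0 → ∀ n,
      walkExp T n (fun g => if ∃ a : ℂ,
        biForm i j (symSq (compC g j) * Φ * symSq (compC g⁻¹ i)) = a • biForm i j Φ
        then 1 else 0) ≤ r ^ n := by
  obtain ⟨b, hb, htr⟩ := hd.exists_hyperbolic
  choose t ht htr using htr
  choose μ v v' hμ hv hv' hmv hmv' using fun k => exists_eigenvectors (det_compC b k) (ht k) (htr k)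
  have hμ0 : ∀ k, μ k ≠ 0 := fun k h => by
    have := hμ k
    rw [h, norm_zero] at this
    linarith
  have hbv : actVec b⁻¹ v = fun k => (μ k)⁻¹ • v k := by
    funext k
    have : v k = (μ k)⁻¹ • (compC b k *ᵥ v k) := by rw [hmv, smul_smul, inv_mul_cancel₀ (hμ0 k),
      one_smul]
    conv_lhs => rw [actVec, this, Matrix.mulVec_smul, Matrix.mulVec_mulVec, compC_inv_mul,
      Matrix.one_mulVec]
  have hbv' : actVec b⁻¹ v' = fun k => μ k • v' k := by
    funext k
    have : v' k = μ k • (compC b k *ᵥ v' k) := by rw [hmv', smul_smul, mul_inv_cancel₀ (hμ0 k),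
      one_smul]
    conv_lhs => rw [actVec, this, Matrix.mulVec_smul, Matrix.mulVec_mulVec, compC_inv_mul,
      Matrix.one_mulVec]
  obtain ⟨N, h, hgen⟩ := exists_general_position
    (I := ↥(Subgroup.closure (T : Set GammaSL)))
    (fun h => biFormEval i j (actVec h v')) (fun h => biFormEval i j (actVec h v)) (by
      intro F hF
      have hex := hd.exists_ne_zero (F ×ˢ (Finset.univ : Finset Bool))
        (fun p m => (p.1 : (Fin 3 → Fin 2 → ℂ) → ℂ) fun k => m k *ᵥ (bif p.2 then v else v') k)
        ?_ ?_ ?_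
      · obtain ⟨g, hg, hgF⟩ := hex
        exact ⟨⟨g, hg⟩, fun w hw =>
          ⟨hgF (w, false) (by simpa using hw), hgF (w, true) (by simpa using hw)⟩⟩
      · rintro ⟨⟨_, Φ, rfl⟩, β⟩ -
        exact biForm_mulVec_mem_polyFun i j Φ _
      · rintro ⟨⟨_, Φ, rfl⟩, β⟩ - m c hc hm
        have := biForm_smul i j Φ c fun k => m k *ᵥ (bif β then v else v') k
        simp only [← Matrix.smul_mulVec] at this
        simp only [this]
        exact mul_ne_zero (mul_ne_zero (pow_ne_zero _ (hc j)) (pow_ne_zero _ (hc i))) hm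
      · rintro ⟨w, β⟩ hw
        have hw0 : (w : (Fin 3 → Fin 2 → ℂ) → ℂ) ≠ 0 := by
          have := hF w (Finset.mem_product.1 hw).1
          simpa using this
        obtain ⟨x, hx⟩ := Function.ne_iff.1 hw0
        have hne : ∀ k, (bif β then v else v') k ≠ 0 := by
          intro k
          cases β
          · exact hv' k
          · exact hv k
        choose m hm using fun k => exists_mulVec_eq (hne k) (x k)
        refine ⟨m, ?_⟩
        simp only [hm]
        exact hx)
  obtain ⟨r, hr0, hr1, hr⟩ := exists_walkExp_fix_line_le hT hne (biFormRep i j)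
    (τ := fun k => (h k : GammaSL) * b * (h k : GammaSL)⁻¹)
    (fun k => mul_mem (mul_mem (h k).2 hb) (inv_mem (h k).2))
    (f := fun k => biFormEval i j (actVec (h k) v'))
    (f' := fun k => biFormEval i j (actVec (h k) v)) (c := μ j ^ 2 * μ i ^ 2)
    (by
      rw [norm_mul, norm_pow, norm_pow]
      exact one_lt_mul_of_lt_of_le (one_lt_pow₀ (hμ j) two_ne_zero) (one_le_pow₀ (hμ i).le))
    (fun k w => biFormEval_conj i j hbv' (h k) w)
    (fun k w => by
      rw [biFormEval_conj i j hbv (h k) w, mul_inv, inv_pow, inv_pow])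
    hgen
  refine ⟨r, hr0, hr1, fun Φ hΦ n => ?_⟩
  refine le_of_eq_of_le ?_ (hr ⟨biForm i j Φ, LinearMap.mem_range_self _ Φ⟩ (fun h0 => hΦ (congrArg Subtype.val h0)) n)
  congr 1
  funext g
  have : (∃ a : ℂ, biForm i j (symSq (compC g j) * Φ * symSq (compC g⁻¹ i)) = a • biForm i j Φ) ↔
      ∃ a : ℂ, biFormRep i j g ⟨biForm i j Φ, LinearMap.mem_range_self _ Φ⟩ = a • ⟨biForm i j Φ, LinearMap.mem_range_self _ Φ⟩ := by
    refine exists_congr fun a => ?_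
    rw [Subtype.ext_iff, funext_iff, funext_iff]
    refine forall_congr' fun x => ?_
    rw [biFormRep_apply, ← biForm_actVec_inv]
    rfl
  simp only [this]

open Classical in
/-- A random walk on a Zariski-dense subgroup fixes the line of a nonzero bihomogeneous form with
exponentially small probability. -/
lemma exists_walkExp_biForm_le {T : Finset GammaSL} (hT : ∀ s ∈ T, s⁻¹ ∈ T)
    (hne : T.Nonempty) (hd : ZariskiDense (Subgroup.closure (T : Set GammaSL))) :
    ∃ r : ℝ, 0 ≤ r ∧ r < 1 ∧ ∀ i j Φ, biForm i j Φ ≠ 0 → ∀ n,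
      walkExp T n (fun g => if ∃ a : ℂ,
        biForm i j (symSq (compC g j) * Φ * symSq (compC g⁻¹ i)) = a • biForm i j Φ
        then 1 else 0) ≤ r ^ n := by
  choose r h0 h1 hr using fun p : Fin 3 × Fin 3 => exists_walkExp_biForm_le_aux hT hne hd p.1 p.2
  obtain ⟨p, -, hp⟩ := Finset.exists_max_image Finset.univ r Finset.univ_nonempty
  refine ⟨r p, h0 p, h1 p, fun i j Φ hΦ n => (hr (i, j) Φ hΦ n).trans ?_⟩
  exact pow_le_pow_left₀ (h0 _) (hp _ (Finset.mem_univ _)) n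

/-- A bihomogeneous form on two distinct factors determines its matrix. -/
lemma eq_zero_of_biForm_eq_zero {i j : Fin 3} (hij : i ≠ j) {Φ : Matrix (Fin 3) (Fin 3) ℂ}
    (h : biForm i j Φ = 0) : Φ = 0 := by
  have key : ∀ x y : Fin 2 → ℂ, coveronese y ⬝ᵥ (Φ *ᵥ veronese x) = 0 := by
    intro x y
    have := congrFun h (fun k => if k = i then x else y)
    simpa [biForm_apply, hij.symm] using this
  have hx : ∀ y : Fin 2 → ℂ, ∀ b, (coveronese y ᵥ* Φ) b = 0 := by
    intro y b
    have h1 := key ![1, 0] y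
    have h2 := key ![0, 1] y
    have h3 := key ![1, 1] y
    rw [Matrix.dotProduct_mulVec] at h1 h2 h3
    simp only [veronese, dotProduct, Fin.sum_univ_three, Matrix.cons_val] at h1 h2 h3
    fin_cases b
    · simpa using h1
    · change (coveronese y ᵥ* Φ) 1 = 0
      linear_combination h3 - h1 - h2
    · simpa using h2
  ext a b
  have h1 := hx ![1, 0] b
  have h2 := hx ![0, 1] b
  have h3 := hx ![1, 1] b
  simp only [coveronese, Matrix.vecMul, dotProduct, Fin.sum_univ_three, Matrix.cons_val] at h1 h2 h3
  fin_cases a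
  · change Φ 0 b = 0
    linear_combination h2
  · change Φ 1 b = 0
    linear_combination (h1 + h2 - h3) / 2
  · change Φ 2 b = 0
    linear_combination h1

/-- A matrix whose quadratic form and the quadratic form of its square vanish on the Veronese
cone is scalar. -/
lemma eq_smul_one_of_biForm_eq_zero {i : Fin 3} {Φ : Matrix (Fin 3) (Fin 3) ℂ}
    (h : biForm i i Φ = 0) (h' : biForm i i (Φ * Φ) = 0) : ∃ a : ℂ, Φ = a • 1 := by
  have key : ∀ Ψ : Matrix (Fin 3) (Fin 3) ℂ, biForm i i Ψ = 0 →
      Ψ 2 0 = 0 ∧ Ψ 2 1 = 2 * Ψ 1 0 ∧ Ψ 0 0 + Ψ 2 2 = 2 * Ψ 1 1 ∧ Ψ 0 1 = 2 * Ψ 1 2 ∧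
        Ψ 0 2 = 0 := by
    intro Ψ hΨ
    have hx : ∀ x : Fin 2 → ℂ, coveronese x ⬝ᵥ (Ψ *ᵥ veronese x) = 0 := fun x =>
      congrFun hΨ (fun _ => x)
    have h1 := hx ![1, 0]
    have h2 := hx ![0, 1]
    have h3 := hx ![1, 1]
    have h4 := hx ![1, -1]
    have h5 := hx ![2, 1]
    simp only [coveronese, veronese, Matrix.mulVec, dotProduct, Fin.sum_univ_three,
      Matrix.cons_val] at h1 h2 h3 h4 h5
    refine ⟨?_, ?_, ?_, ?_, ?_⟩
    · linear_combination h1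
    · linear_combination (h5 - 16 * h1 - h2) / 6 - (h3 + h4 - 2 * h1 - 2 * h2) / 3
        - (h3 - h4) / 6
    · linear_combination (h3 + h4) / 2 - h1 - h2
    · linear_combination (h3 - h4) / 2 - ((h5 - 16 * h1 - h2) / 6 - (h3 + h4 - 2 * h1 - 2 * h2) / 3
        - (h3 - h4) / 6)
    · linear_combination h2
  obtain ⟨h20, h21, hd, h01, h02⟩ := key Φ h
  obtain ⟨k20, -, kd, -, k02⟩ := key _ h'
  simp only [Matrix.mul_apply, Fin.sum_univ_three] at k20 kd k02
  have h10 : Φ 1 0 = 0 := by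
    rw [h20, h21] at k20
    have : Φ 1 0 ^ 2 = 0 := by linear_combination k20 / 2
    simpa using this
  have h12 : Φ 1 2 = 0 := by
    rw [h02, h01] at k02
    have : Φ 1 2 ^ 2 = 0 := by linear_combination k02 / 2
    simpa using this
  rw [h10, mul_zero] at h21
  rw [h12, mul_zero] at h01
  rw [h10, h12, h20, h21, h01, h02] at kd
  have h22 : Φ 2 2 = Φ 0 0 := by
    have : (Φ 0 0 - Φ 2 2) ^ 2 = 0 := by
      linear_combination 2 * kd - (Φ 0 0 + Φ 2 2 + 2 * Φ 1 1) * hd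
    have := pow_eq_zero_iff two_ne_zero |>.1 this
    linear_combination -this
  have h11 : Φ 1 1 = Φ 0 0 := by
    rw [h22] at hd
    linear_combination -hd / 2
  refine ⟨Φ 0 0, ?_⟩
  ext a b
  fin_cases a <;> fin_cases b <;> simp [h20, h21, h01, h02, h10, h12, h22, h11]

/-- The isomorphism of the symmetric square with its dual. -/
def symSqDual (d : Fin 3 → ℂ) : Fin 3 → ℂ := ![d 2, -2 * d 1, d 0]

lemma symSqDual_smul (a : ℂ) (d : Fin 3 → ℂ) : symSqDual (a • d) = a • symSqDual d := by
  funext k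
  fin_cases k <;> simp [symSqDual]
  ring

lemma symSqDual_ne_zero {d : Fin 3 → ℂ} (hd : d ≠ 0) : symSqDual d ≠ 0 := by
  intro h
  apply hd
  have h0 := congrFun h 0
  have h1 := congrFun h 1
  have h2 := congrFun h 2
  simp only [symSqDual, Matrix.cons_val, Pi.zero_apply] at h0 h1 h2
  funext k
  fin_cases k
  · exact h2
  · simpa using h1
  · exact h0

lemma symSqDual_mulVec_vecMul {m : Matrix (Fin 2) (Fin 2) ℂ} (hm : m.det = 1) (d : Fin 3 → ℂ) :
    symSqDual (symSq m *ᵥ d) ᵥ* symSq m = symSqDual d := by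
  rw [Matrix.det_fin_two] at hm
  have h2 : (m 0 0 * m 1 1 - m 0 1 * m 1 0) ^ 2 = 1 := by rw [hm, one_pow]
  funext i
  fin_cases i <;>
    simp [symSq, symSqDual, Matrix.mulVec, Matrix.vecMul, dotProduct, Fin.sum_univ_three]
  · linear_combination d 2 * h2
  · linear_combination -2 * d 1 * h2
  · linear_combination d 0 * h2

/-- A proper nonzero subspace of the symmetric square yields a covector which is an eigenvector of
every unimodular matrix preserving the subspace. -/
lemma exists_covector_of_submodule {D : Submodule ℂ (Fin 3 → ℂ)} (h0 : D ≠ ⊥) (h1 : D ≠ ⊤) :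
    ∃ u : Fin 3 → ℂ, u ≠ 0 ∧ ∀ m m' : Matrix (Fin 2) (Fin 2) ℂ, m.det = 1 → m * m' = 1 →
      (∀ d ∈ D, symSq m *ᵥ d ∈ D) → (∀ d ∈ D, symSq m' *ᵥ d ∈ D) →
        ∃ a : ℂ, u ᵥ* symSq m' = a • u := by
  have hr : Module.finrank ℂ D = 1 ∨ Module.finrank ℂ D = 2 := by
    have ha : Module.finrank ℂ D ≠ 0 := fun h => h0 (Submodule.finrank_eq_zero.1 h)
    have hb := Submodule.finrank_lt h1
    rw [Module.finrank_fin_fun] at hb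
    omega
  rcases hr with hr | hr
  · obtain ⟨d, hd0, hd⟩ := finrank_eq_one_iff'.1 hr
    refine ⟨symSqDual d, symSqDual_ne_zero fun h => hd0 (Subtype.ext h), ?_⟩
    intro m m' hm hmm hD hD'
    obtain ⟨a, ha⟩ := hd ⟨_, hD d d.2⟩
    refine ⟨a, ?_⟩
    have ha' : a • (d : Fin 3 → ℂ) = symSq m *ᵥ d := congrArg Subtype.val ha
    have := symSqDual_mulVec_vecMul hm d
    conv_lhs => rw [← this, ← ha', Matrix.vecMul_vecMul, ← symSq_mul, hmm, symSq_one, Matrix.vecMul_one,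
      symSqDual_smul]
  · have h2 := Subspace.finrank_add_finrank_dualAnnihilator_eq D
    rw [hr, Module.finrank_fin_fun] at h2
    obtain ⟨f, hf0, hf⟩ := finrank_eq_one_iff'.1
      (show Module.finrank ℂ D.dualAnnihilator = 1 by omega)
    have hfu : ∀ f : Module.Dual ℂ (Fin 3 → ℂ), ∃ u : Fin 3 → ℂ, ∀ x, f x = u ⬝ᵥ x := by
      intro f
      refine ⟨fun k => f (Pi.single k 1), fun x => ?_⟩
      conv_lhs => rw [← Finset.univ_sum_single x, map_sum]
      refine Finset.sum_congr rfl fun k _ => ?_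
      have : (Pi.single k (x k) : Fin 3 → ℂ) = x k • Pi.single k 1 := by
        rw [← Pi.single_smul, smul_eq_mul, mul_one]
      rw [this, map_smul, smul_eq_mul, mul_comm]
    obtain ⟨u, hu⟩ := hfu f
    refine ⟨u, fun h => hf0 (Subtype.ext (LinearMap.ext fun x => ?_)), ?_⟩
    · rw [hu, h, zero_dotProduct]
      rfl
    intro m m' hm hmm hD hD'
    obtain ⟨a, ha⟩ := hf ⟨(f : Module.Dual ℂ (Fin 3 → ℂ)) ∘ₗ (symSq m').mulVecLin, by
      rw [Submodule.mem_dualAnnihilator]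
      intro w hw
      exact (Submodule.mem_dualAnnihilator _).1 f.2 _ (hD' w hw)⟩
    refine ⟨a, ?_⟩
    funext k
    have := congrArg (fun q : Module.Dual ℂ (Fin 3 → ℂ) => q (Pi.single k 1))
      (congrArg Subtype.val ha)
    simp only [SetLike.val_smul, LinearMap.smul_apply, LinearMap.comp_apply, hu,
      Matrix.mulVecLin_apply, Matrix.dotProduct_mulVec, smul_eq_mul, dotProduct_single,
      mul_one] at this
    rw [Pi.smul_apply, smul_eq_mul, this]

/-- The square of a nonzero quadratic form is a nonzero bihomogeneous form. -/
lemma exists_biForm_of_covector (i : Fin 3) {u : Fin 3 → ℂ} (hu : u ≠ 0) :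
    ∃ Φ, biForm i i Φ ≠ 0 ∧ ∀ g : GammaSL, (∃ a : ℂ, u ᵥ* symSq (compC g⁻¹ i) = a • u) →
      ∃ a : ℂ, biForm i i (symSq (compC g i) * Φ * symSq (compC g⁻¹ i)) = a • biForm i i Φ := by
  have key : ∀ x, biForm i i (Matrix.vecMulVec ![u 2, -u 1 / 2, u 0] u) x =
      (u ⬝ᵥ veronese (x i)) ^ 2 := by
    intro x
    rw [biForm_apply, Matrix.vecMulVec_mulVec]
    simp [coveronese, veronese, dotProduct, Fin.sum_univ_three]
    ring
  refine ⟨Matrix.vecMulVec ![u 2, -u 1 / 2, u 0] u, fun h => hu ?_, ?_⟩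
  · have hx : ∀ x : Fin 2 → ℂ, u ⬝ᵥ veronese x = 0 := by
      intro x
      have := congrFun h fun _ => x
      rw [key] at this
      exact pow_eq_zero_iff two_ne_zero |>.1 this
    have h1 := hx ![1, 0]
    have h2 := hx ![0, 1]
    have h3 := hx ![1, 1]
    simp only [veronese, dotProduct, Fin.sum_univ_three, Matrix.cons_val] at h1 h2 h3
    funext k
    fin_cases k
    · simpa using h1
    · change u 1 = 0
      linear_combination h3 - h1 - h2
    · simpa using h2
  · rintro g ⟨a, ha⟩
    refine ⟨a ^ 2, funext fun x => ?_⟩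
    rw [← biForm_actVec_inv, key, Pi.smul_apply, key, actVec, ← symSq_mulVec_veronese,
      Matrix.dotProduct_mulVec, ha, smul_dotProduct, smul_eq_mul, smul_eq_mul, mul_pow]

/-- The action of `SL₂(ℤ)³` on nine copies of the symmetric square, indexed by the factor through
which the group acts and a multiplicity index. -/
noncomputable def actW : GammaSL →* Module.End ℂ (Fin 3 × Fin 3 → Fin 3 → ℂ) where
  toFun g := LinearMap.pi fun p => (symSq (compC g p.1)).mulVecLin ∘ₗ LinearMap.proj p
  map_one' := by
    ext w p k
    simp [compC_one, symSq_one]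
  map_mul' g h := by
    refine LinearMap.ext fun w => funext fun p => ?_
    simp [compC_mul, symSq_mul, Matrix.mulVec_mulVec]

lemma actW_apply (g : GammaSL) (w : Fin 3 × Fin 3 → Fin 3 → ℂ) (p : Fin 3 × Fin 3) :
    actW g w p = symSq (compC g p.1) *ᵥ w p := rfl

lemma symSq_conj_eq {g : GammaSL} {i j : Fin 3} {Φ : Matrix (Fin 3) (Fin 3) ℂ}
    (h : symSq (compC g j) * Φ = Φ * symSq (compC g i)) :
    symSq (compC g j) * Φ * symSq (compC g⁻¹ i) = Φ := by
  rw [h, Matrix.mul_assoc, ← symSq_mul, compC_mul_inv, symSq_one, Matrix.mul_one]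

/-- A nonzero subspace either contains a nonzero invariant subspace, or its stabilizer fixes the
line of a nonzero bihomogeneous form. -/
lemma exists_invariant_or_exists_biForm {U : Submodule ℂ (Fin 3 × Fin 3 → Fin 3 → ℂ)}
    (hU : U ≠ ⊥) :
    (∃ V ≤ U, V ≠ ⊥ ∧ ∀ g, ∀ w ∈ V, actW g w ∈ V) ∨
    ∃ i j Φ, biForm i j Φ ≠ 0 ∧ ∀ g, U.map (actW g) = U →
      ∃ a : ℂ, biForm i j (symSq (compC g j) * Φ * symSq (compC g⁻¹ i)) = a • biForm i j Φ := by
  classical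
  set K : Finset (Fin 3 × Fin 3) → Submodule ℂ (Fin 3 × Fin 3 → Fin 3 → ℂ) :=
    fun J => ⨅ p ∈ Jᶜ, LinearMap.ker (LinearMap.proj p) with hK
  have mem_K : ∀ J w, w ∈ K J ↔ ∀ p ∉ J, w p = 0 := by
    intro J w
    simp [hK, Submodule.mem_iInf]
  obtain ⟨J, hJ, hmin⟩ := Finset.exists_min_image
    (Finset.univ.filter fun J => U ⊓ K J ≠ ⊥) Finset.card ⟨Finset.univ, by
      rw [Finset.mem_filter]
      refine ⟨Finset.mem_univ _, ?_⟩
      have : K Finset.univ = ⊤ := by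
        rw [eq_top_iff]
        intro w _
        rw [mem_K]
        intro p hp
        exact absurd (Finset.mem_univ p) hp
      rwa [this, inf_top_eq]⟩
  have hJ0 := (Finset.mem_filter.1 hJ).2
  obtain ⟨p, hp⟩ : J.Nonempty := by
    rw [Finset.nonempty_iff_ne_empty]
    rintro rfl
    apply hJ0
    rw [eq_bot_iff]
    intro w hw
    exact funext fun p => (mem_K _ _).1 hw.2 p (Finset.notMem_empty p)
  set V := U ⊓ K J with hV
  set π : V →ₗ[ℂ] (Fin 3 → ℂ) := LinearMap.proj p ∘ₗ V.subtype with hπ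
  have hπ_apply : ∀ w : V, π w = (w : Fin 3 × Fin 3 → Fin 3 → ℂ) p := fun w => rfl
  have hinj : Function.Injective π := by
    rw [← LinearMap.ker_eq_bot, LinearMap.ker_eq_bot']
    rintro ⟨w, hw⟩ hw0
    by_contra hne
    have hmem : J.erase p ∈ Finset.univ.filter fun J => U ⊓ K J ≠ ⊥ := by
      rw [Finset.mem_filter]
      refine ⟨Finset.mem_univ _, fun hbot => hne ?_⟩
      have : w ∈ U ⊓ K (J.erase p) := by
        refine ⟨hw.1, (mem_K _ _).2 fun q hq => ?_⟩
        by_cases hqp : q = p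
        · rw [hqp]
          exact hw0
        · exact (mem_K _ _).1 hw.2 q fun hqJ => hq (Finset.mem_erase.2 ⟨hqp, hqJ⟩)
      rw [hbot] at this
      exact Subtype.ext ((Submodule.mem_bot ℂ).1 this)
    have := hmin _ hmem
    rw [Finset.card_erase_of_mem hp] at this
    have := Finset.card_pos.2 ⟨p, hp⟩
    omega
  have hstab : ∀ g, U.map (actW g) = U → ∀ w ∈ V, actW g w ∈ V := by
    intro g hg w hw
    refine ⟨hg ▸ Submodule.mem_map_of_mem hw.1, (mem_K _ _).2 fun q hq => ?_⟩
    rw [actW_apply, (mem_K _ _).1 hw.2 q hq, Matrix.mulVec_zero]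
  have hstab_inv : ∀ g, U.map (actW g) = U → U.map (actW g⁻¹) = U := by
    intro g hg
    conv_lhs => rw [← hg]
    rw [← Submodule.map_comp, ← Module.End.mul_eq_comp, ← map_mul, inv_mul_cancel, map_one]
    exact Submodule.map_id U
  have hrange : ∀ g, U.map (actW g) = U → ∀ d ∈ LinearMap.range π,
      symSq (compC g p.1) *ᵥ d ∈ LinearMap.range π := by
    rintro g hg _ ⟨w, rfl⟩
    exact ⟨⟨_, hstab g hg w w.2⟩, rfl⟩
  by_cases htop : LinearMap.range π = ⊤
  swap
  · right
    have hbot : LinearMap.range π ≠ ⊥ := by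
      intro h
      rw [LinearMap.range_eq_bot] at h
      apply hJ0
      rw [eq_bot_iff]
      intro w hw
      have : (⟨w, hw⟩ : V) = 0 := hinj (by rw [h]; rfl)
      exact congrArg Subtype.val this
    obtain ⟨u, hu, hum⟩ := exists_covector_of_submodule hbot htop
    obtain ⟨Φ, hΦ, hΦm⟩ := exists_biForm_of_covector p.1 hu
    refine ⟨p.1, p.1, Φ, hΦ, fun g hg => hΦm g ?_⟩
    exact hum _ _ (det_compC g p.1) (compC_mul_inv g p.1) (hrange g hg)
      (hrange g⁻¹ (hstab_inv g hg))
  set E := LinearEquiv.ofBijective π ⟨hinj, LinearMap.range_eq_top.1 htop⟩ with hE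
  have hEp : ∀ d, (E.symm d : Fin 3 × Fin 3 → Fin 3 → ℂ) p = d := fun d =>
    E.apply_symm_apply d
  set Φ : Fin 3 × Fin 3 → Matrix (Fin 3) (Fin 3) ℂ := fun q =>
    LinearMap.toMatrix' (LinearMap.proj q ∘ₗ V.subtype ∘ₗ E.symm.toLinearMap) with hΦ
  have hΦ_apply : ∀ q d, Φ q *ᵥ d = (E.symm d : Fin 3 × Fin 3 → Fin 3 → ℂ) q := by
    intro q d
    rw [hΦ, LinearMap.toMatrix'_mulVec]
    rfl
  have hcomm : ∀ g, U.map (actW g) = U → ∀ q,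
      symSq (compC g q.1) * Φ q = Φ q * symSq (compC g p.1) := by
    intro g hg q
    have hw : ∀ d, (⟨_, hstab g hg _ (E.symm d).2⟩ : V) = E.symm (symSq (compC g p.1) *ᵥ d) := by
      intro d
      rw [LinearEquiv.eq_symm_apply]
      change symSq (compC g p.1) *ᵥ (E.symm d : Fin 3 × Fin 3 → Fin 3 → ℂ) p = _
      rw [hEp]
    refine Matrix.toLin'.injective (LinearMap.ext fun d => ?_)
    rw [Matrix.toLin'_apply, Matrix.toLin'_apply, ← Matrix.mulVec_mulVec, ← Matrix.mulVec_mulVec,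
      hΦ_apply, hΦ_apply, ← hw]
    rfl
  by_cases h1 : ∃ q, q.1 ≠ p.1 ∧ Φ q ≠ 0
  · obtain ⟨q, hq, hq0⟩ := h1
    refine Or.inr ⟨p.1, q.1, Φ q, fun h => hq0 (eq_zero_of_biForm_eq_zero hq.symm h), ?_⟩
    intro g hg
    exact ⟨1, by rw [symSq_conj_eq (hcomm g hg q), one_smul]⟩
  push Not at h1
  by_cases h2 : ∃ q : Fin 3 × Fin 3, q.1 = p.1 ∧
      (biForm p.1 p.1 (Φ q) ≠ 0 ∨ biForm p.1 p.1 (Φ q * Φ q) ≠ 0)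
  · right
    obtain ⟨q, hq, hq0⟩ := h2
    have hc : ∀ g, U.map (actW g) = U →
        symSq (compC g p.1) * Φ q = Φ q * symSq (compC g p.1) := by
      intro g hg
      have := hcomm g hg q
      rwa [hq] at this
    rcases hq0 with hq0 | hq0
    · refine ⟨p.1, p.1, Φ q, hq0, fun g hg => ⟨1, ?_⟩⟩
      rw [symSq_conj_eq (hc g hg), one_smul]
    · refine ⟨p.1, p.1, Φ q * Φ q, hq0, fun g hg => ⟨1, ?_⟩⟩
      rw [symSq_conj_eq, one_smul]
      rw [← Matrix.mul_assoc, hc g hg, Matrix.mul_assoc, hc g hg, Matrix.mul_assoc]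
  push Not at h2
  have hscal : ∀ q : Fin 3 × Fin 3, ∃ a : ℂ, Φ q = a • 1 ∧ (q.1 ≠ p.1 → a = 0) := by
    intro q
    by_cases hq : q.1 = p.1
    · obtain ⟨a, ha⟩ := eq_smul_one_of_biForm_eq_zero (h2 q hq).1 (h2 q hq).2
      exact ⟨a, ha, fun h => absurd hq h⟩
    · exact ⟨0, by rw [h1 q hq, zero_smul], fun _ => rfl⟩
  choose a ha ha0 using hscal
  refine Or.inl ⟨V, inf_le_left, hJ0, fun g w hw => ?_⟩
  have hw' : ∀ d q, (E.symm d : Fin 3 × Fin 3 → Fin 3 → ℂ) q = a q • d := by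
    intro d q
    rw [← hΦ_apply, ha, Matrix.smul_mulVec, Matrix.one_mulVec]
  have : actW g w = E.symm (symSq (compC g p.1) *ᵥ π ⟨w, hw⟩) := by
    funext q
    have hwq : w q = a q • π ⟨w, hw⟩ := by
      rw [← hw', hE]
      have := E.symm_apply_apply ⟨w, hw⟩
      exact (congrFun (congrArg Subtype.val this) q).symm
    rw [actW_apply, hw', hwq, Matrix.mulVec_smul]
    by_cases hq : q.1 = p.1
    · rw [hq]
    · rw [ha0 q hq, zero_smul, zero_smul]
  rw [this]
  exact (E.symm _).2

/-- The embedding of `SL₂(ℤ)` as the `i`-th factor. -/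
def embSL (i : Fin 3) (m : SL2Z) : GammaSL :=
  (if i = 0 then m else 1, if i = 1 then m else 1, if i = 2 then m else 1)

lemma compC_embSL_self (i : Fin 3) (m : SL2Z) :
    compC (embSL i m) i = (m : Matrix (Fin 2) (Fin 2) ℤ).map (Int.castRingHom ℂ) := by
  ext a b
  fin_cases i <;> rfl

lemma compC_embSL_of_ne {i j : Fin 3} (h : j ≠ i) (m : SL2Z) : compC (embSL i m) j = 1 := by
  rw [← compC_one j]
  ext a b
  fin_cases i <;> fin_cases j <;> first | exact absurd rfl h | rfl

/-- The matrix coefficients of the symmetric square are linearly independent. -/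
lemma eq_zero_of_symSq_trace {v : Fin 3 → Fin 3 → ℂ}
    (h : ∀ m : SL2Z, ∑ j, (symSq ((m : Matrix (Fin 2) (Fin 2) ℤ).map (Int.castRingHom ℂ)) *ᵥ v j) j =
      ∑ j, v j j) : v = 0 := by
  have key : ∀ a b c d : ℤ, a * d - b * c = 1 →
      (a ^ 2 : ℂ) * v 0 0 + 2 * a * b * v 0 1 + b ^ 2 * v 0 2 + a * c * v 1 0 +
        (a * d + b * c) * v 1 1 + b * d * v 1 2 + c ^ 2 * v 2 0 + 2 * c * d * v 2 1 +
        d ^ 2 * v 2 2 = v 0 0 + v 1 1 + v 2 2 := by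
    intro a b c d hdet
    have := h ⟨!![a, b; c, d], by rw [Matrix.det_fin_two_of]; exact hdet⟩
    simp only [Fin.sum_univ_three, symSq, Matrix.mulVec, dotProduct, Matrix.of_apply,
      Matrix.map_apply, Matrix.cons_val, eq_intCast] at this
    linear_combination this
  have e1 := key 0 (-1) 1 0 (by norm_num)
  have e2 := key (-1) (-1) 0 (-1) (by norm_num)
  have e3 := key (-1) (-1) 1 0 (by norm_num)
  have e4 := key (-1) 0 (-1) (-1) (by norm_num)
  have e5 := key (-1) 0 1 (-1) (by norm_num)
  have e6 := key (-1) 1 (-1) 0 (by norm_num)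
  have e7 := key (-1) 1 0 (-1) (by norm_num)
  have e8 := key 0 (-1) 1 (-1) (by norm_num)
  have e9 := key (-2) (-1) (-1) (-1) (by norm_num)
  push_cast at e1 e2 e3 e4 e5 e6 e7 e8 e9
  funext j k
  fin_cases j <;> fin_cases k
  · change v 0 0 = 0
    linear_combination (-1) * e1 + (1/2) * e3 + (1/2) * e6
  · change v 0 1 = 0
    linear_combination (1/2) * e1 + (-1/2) * e2 + (-1/4) * e4 + (-1/4) * e5 + (-1/2) * e6 + (1/4) * e8 + (1/4) * e9
  · change v 0 2 = 0
    linear_combination (1/2) * e2 + (1/2) * e7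
  · change v 1 0 = 0
    linear_combination (1) * e1 + (-1) * e2 + (-1/2) * e3 + (-1/2) * e4 + (-1/2) * e5 + (-1/2) * e6 + (1/2) * e8 + (1/2) * e9
  · change v 1 1 = 0
    linear_combination (1/2) * e1 + (1/2) * e2 + (-1/2) * e3 + (1/2) * e5 + (-1/2) * e8
  · change v 1 2 = 0
    linear_combination (-1) * e1 + (3/2) * e2 + (1/2) * e4 + (1/2) * e5 + (1) * e6 + (-1/2) * e7 + (-1/2) * e8 + (-1/2) * e9
  · change v 2 0 = 0
    linear_combination (1/2) * e4 + (1/2) * e5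
  · change v 2 1 = 0
    linear_combination (-1/2) * e1 + (1/2) * e2 + (1/4) * e3 + (1/2) * e4 + (1/4) * e6 + (-1/4) * e8 + (-1/4) * e9
  · change v 2 2 = 0
    linear_combination (-1) * e1 + (-1/2) * e2 + (1/2) * e3 + (1/2) * e4 + (-1/2) * e5 + (-1/2) * e6 + (1/2) * e7 + (1) * e8

/-- The linear functional sending `w` to the sum of its diagonal coordinates. -/
noncomputable def evW : (Fin 3 × Fin 3 → Fin 3 → ℂ) →ₗ[ℂ] ℂ :=
  ∑ p : Fin 3 × Fin 3, LinearMap.proj p.2 ∘ₗ LinearMap.proj p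

lemma evW_apply (w : Fin 3 × Fin 3 → Fin 3 → ℂ) : evW w = ∑ i, ∑ j, w (i, j) j := by
  simp [evW, Fintype.sum_prod_type]

/-- The functional `evW` does not vanish on a nonzero invariant subspace. -/
lemma eq_bot_of_evW_eq_zero {V : Submodule ℂ (Fin 3 × Fin 3 → Fin 3 → ℂ)}
    (hV : ∀ g, ∀ w ∈ V, actW g w ∈ V) (h0 : ∀ w ∈ V, evW w = 0) : V = ⊥ := by
  rw [eq_bot_iff]
  intro w hw
  rw [Submodule.mem_bot]
  have key : ∀ i, (fun j => w (i, j)) = 0 := by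
    intro i
    refine eq_zero_of_symSq_trace fun m => ?_
    have h1 := h0 _ (hV (embSL i m) w hw)
    have h2 := h0 w hw
    rw [evW_apply, ← Finset.add_sum_erase _ _ (Finset.mem_univ i)] at h1 h2
    have h3 : ∑ x ∈ Finset.univ.erase i, ∑ j, actW (embSL i m) w (x, j) j =
        ∑ x ∈ Finset.univ.erase i, ∑ j, w (x, j) j := by
      refine Finset.sum_congr rfl fun x hx => Finset.sum_congr rfl fun j _ => ?_
      rw [actW_apply, compC_embSL_of_ne (Finset.ne_of_mem_erase hx), symSq_one,
        Matrix.one_mulVec]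
    rw [h3] at h1
    simp only [actW_apply, compC_embSL_self] at h1
    linear_combination h1 - h2
  funext p
  exact congrFun (key p.1) p.2

/-- The set of group elements mapping a subspace into the kernel of `evW`. -/
def annSet (U : Submodule ℂ (Fin 3 × Fin 3 → Fin 3 → ℂ)) : Set GammaSL :=
  {g | ∀ w ∈ U, evW (actW g w) = 0}

lemma mem_annSet_map {U : Submodule ℂ (Fin 3 × Fin 3 → Fin 3 → ℂ)} {g h : GammaSL} :
    g ∈ annSet (U.map (actW h)) ↔ g * h ∈ annSet U := by
  simp [annSet, map_mul]

lemma mem_annSet_sup {U V : Submodule ℂ (Fin 3 × Fin 3 → Fin 3 → ℂ)} {g : GammaSL} :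
    g ∈ annSet (U ⊔ V) ↔ g ∈ annSet U ∧ g ∈ annSet V := by
  constructor
  · intro h
    exact ⟨fun w hw => h w (Submodule.mem_sup_left hw), fun w hw => h w (Submodule.mem_sup_right hw)⟩
  · rintro ⟨h1, h2⟩ w hw
    obtain ⟨u, hu, v, hv, rfl⟩ := Submodule.mem_sup.1 hw
    rw [map_add, map_add, h1 u hu, h2 v hv, add_zero]

lemma notMem_annSet_of_invariant {U V : Submodule ℂ (Fin 3 × Fin 3 → Fin 3 → ℂ)} (hVU : V ≤ U)
    (hV0 : V ≠ ⊥) (hV : ∀ g, ∀ w ∈ V, actW g w ∈ V) (g : GammaSL) : g ∉ annSet U := by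
  intro hg
  refine hV0 (eq_bot_of_evW_eq_zero hV fun w hw => ?_)
  have := hg _ (hVU (hV g⁻¹ w hw))
  rwa [← Module.End.mul_apply, ← map_mul, mul_inv_cancel, map_one] at this

lemma finrank_map_actW (g : GammaSL) (U : Submodule ℂ (Fin 3 × Fin 3 → Fin 3 → ℂ)) :
    Module.finrank ℂ (U.map (actW g)) = Module.finrank ℂ U := by
  refine (Submodule.equivMapOfInjective (actW g) ?_ U).finrank_eq.symm
  refine Function.LeftInverse.injective (g := actW g⁻¹) fun w => ?_
  rw [← Module.End.mul_apply, ← map_mul, inv_mul_cancel, map_one]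
  rfl

lemma map_actW_eq_iff {x y : GammaSL} {U : Submodule ℂ (Fin 3 × Fin 3 → Fin 3 → ℂ)} :
    U.map (actW x) = U.map (actW y) ↔ U.map (actW (x⁻¹ * y)) = U := by
  have hmap : ∀ a b, (U.map (actW b)).map (actW a) = U.map (actW (a * b)) := by
    intro a b
    rw [← Submodule.map_comp, ← Module.End.mul_eq_comp, ← map_mul]
  have hone : U.map (actW 1) = U := by
    rw [map_one]
    exact Submodule.map_id U
  constructor
  · intro h
    rw [← hmap, ← h, hmap, inv_mul_cancel, hone]
  · intro h
    conv_lhs => rw [← h]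
    rw [hmap, mul_inv_cancel_left]

open Classical in
/-- The key `L²` step: the probability of landing in `annSet U` is controlled by larger subspaces
and the stabilizer of `U`. -/
lemma sq_walkExp_annSet_le {T : Finset GammaSL} (hT : ∀ s ∈ T, s⁻¹ ∈ T) (hne : T.Nonempty)
    {U : Submodule ℂ (Fin 3 × Fin 3 → Fin 3 → ℂ)} {n : ℕ} {δ : ℝ} (hδ : 0 ≤ δ)
    (h : ∀ V : Submodule ℂ (Fin 3 × Fin 3 → Fin 3 → ℂ), Module.finrank ℂ U < Module.finrank ℂ V →
      walkExp T n (fun g => if g ∈ annSet V then 1 else 0) ≤ δ) :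
    walkExp T (n + n) (fun g => if g ∈ annSet U then 1 else 0) ^ 2 ≤
      walkExp T (n + n) (fun g => if U.map (actW g) = U then 1 else 0) + δ := by
  rw [walkExp_comp_add]
  refine (sq_walkExp_le hne _ _).trans ?_
  have h1 : ∀ x, walkExp T n (fun y => if x * y ∈ annSet U then (1 : ℝ) else 0) ^ 2 =
      walkExp T n (fun y => walkExp T n (fun y' =>
        if x ∈ annSet (U.map (actW y) ⊔ U.map (actW y')) then 1 else 0)) := by
    intro x
    rw [sq, ← walkExp_mul_left]
    congr 1
    funext y
    rw [mul_comm, ← walkExp_mul_left]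
    congr 1
    funext y'
    simp only [mem_annSet_sup, mem_annSet_map]
    by_cases hy : x * y ∈ annSet U <;> by_cases hy' : x * y' ∈ annSet U <;> simp [hy, hy']
  simp only [h1]
  rw [walkExp_comm]
  have h2 : ∀ y, walkExp T n (fun x => walkExp T n (fun y' =>
      if x ∈ annSet (U.map (actW y) ⊔ U.map (actW y')) then (1 : ℝ) else 0)) ≤
      walkExp T n (fun y' => if U.map (actW (y⁻¹ * y')) = U then 1 else 0) + δ := by
    intro y
    rw [walkExp_comm]
    have : walkExp T n (fun y' => if U.map (actW (y⁻¹ * y')) = U then 1 else 0) + δ =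
        walkExp T n (fun y' => (if U.map (actW (y⁻¹ * y')) = U then 1 else 0) + δ) := by
      rw [walkExp_add, walkExp_const hne]
    rw [this]
    refine walkExp_mono fun y' => ?_
    split_ifs with hy
    · refine (walkExp_mono (ψ := fun _ => 1) fun x => ?_).trans ?_
      · split_ifs <;> norm_num
      · rw [walkExp_const hne]
        linarith
    · rw [zero_add]
      refine h _ ?_
      rw [← finrank_map_actW y U]
      refine Submodule.finrank_lt_finrank_of_lt (lt_of_le_of_ne le_sup_left fun heq => hy ?_)
      rw [← map_actW_eq_iff]
      refine (Submodule.eq_of_le_of_finrank_eq (le_sup_right.trans heq.ge) ?_).symm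
      rw [finrank_map_actW, finrank_map_actW]
  refine (walkExp_mono h2).trans ?_
  rw [walkExp_add, walkExp_const hne, walkExp_comp_add n n,
    walkExp_inv hT n (fun y => walkExp T n (fun y' => if U.map (actW (y * y')) = U then 1 else 0))]

open Classical in
lemma exists_walkExp_annSet_le_aux {T : Finset GammaSL} (hT : ∀ s ∈ T, s⁻¹ ∈ T)
    (hne : T.Nonempty) (hd : ZariskiDense (Subgroup.closure (T : Set GammaSL))) (m : ℕ) :
    ∃ C ρ : ℝ, 0 ≤ C ∧ 0 ≤ ρ ∧ ρ < 1 ∧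
      ∀ U : Submodule ℂ (Fin 3 × Fin 3 → Fin 3 → ℂ), U ≠ ⊥ → 28 ≤ Module.finrank ℂ U + m →
        ∀ n, walkExp T n (fun g => if g ∈ annSet U then 1 else 0) ≤ C * ρ ^ n := by
  induction m with
  | zero =>
    refine ⟨0, 0, le_rfl, le_rfl, one_pos, fun U _ hU => ?_⟩
    have := Submodule.finrank_le U
    have hW : Module.finrank ℂ (Fin 3 × Fin 3 → Fin 3 → ℂ) = 27 := by
      rw [Module.finrank_pi_fintype]
      simp
    omega
  | succ m ih =>
    obtain ⟨C, ρ, hC, hρ0, hρ1, ih⟩ := ih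
    obtain ⟨r, hr0, hr1, hr⟩ := exists_walkExp_biForm_le hT hne hd
    set s := max (max (r ^ 2) ρ) (1 / 2) with hs
    have hs0 : 0 < s := lt_max_of_lt_right (by norm_num)
    have hs1 : s < 1 := max_lt (max_lt (pow_lt_one₀ hr0 hr1 two_ne_zero) hρ1) (by norm_num)
    set t := √(√s) with ht
    have ht0 : 0 < t := Real.sqrt_pos.2 (Real.sqrt_pos.2 hs0)
    have ht4 : t ^ 4 = s := by
      rw [show 4 = 2 * 2 from rfl, pow_mul, Real.sq_sqrt (Real.sqrt_nonneg _), Real.sq_sqrt hs0.le]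
    have ht1 : t < 1 := by
      by_contra! h
      exact absurd hs1 (not_lt.2 (ht4 ▸ one_le_pow₀ h))
    refine ⟨√(1 + C) / t, t, by positivity, ht0.le, ht1, fun U hU0 hU => ?_⟩
    have heven : ∀ U : Submodule ℂ (Fin 3 × Fin 3 → Fin 3 → ℂ), U ≠ ⊥ →
        28 ≤ Module.finrank ℂ U + (m + 1) → ∀ n,
        walkExp T (n + n) (fun g => if g ∈ annSet U then 1 else 0) ≤ √(1 + C) * t ^ (n + n) := by
      intro U hU0 hU n
      rcases exists_invariant_or_exists_biForm hU0 with ⟨V, hVU, hV0, hV⟩ | ⟨i, j, Φ, hΦ, hst⟩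
      · simp only [notMem_annSet_of_invariant hVU hV0 hV, if_false]
        rw [walkExp_const hne]
        positivity
      · refine le_of_sq_le_sq ?_ (by positivity)
        refine (sq_walkExp_annSet_le hT hne (δ := C * ρ ^ n) (by positivity) fun V hV =>
          ih V ?_ (by omega) n).trans ?_
        · rintro rfl
          simp at hV
        have h1 : walkExp T (n + n) (fun g => if U.map (actW g) = U then (1 : ℝ) else 0) ≤
            r ^ (n + n) := by
          refine (walkExp_mono fun g => ?_).trans (hr i j Φ hΦ (n + n))
          by_cases hg : U.map (actW g) = U
          · rw [if_pos hg, if_pos (hst g hg)]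
          · rw [if_neg hg]
            split_ifs <;> norm_num
        have h2 : r ^ (n + n) ≤ s ^ n := by
          rw [← two_mul, pow_mul]
          exact pow_le_pow_left₀ (by positivity) ((le_max_left _ _).trans (le_max_left _ _)) n
        have h3 : ρ ^ n ≤ s ^ n :=
          pow_le_pow_left₀ hρ0 ((le_max_right _ _).trans (le_max_left _ _)) n
        have h4 : (√(1 + C) * t ^ (n + n)) ^ 2 = (1 + C) * s ^ n := by
          rw [mul_pow, Real.sq_sqrt (by positivity), ← ht4]
          ring
        rw [h4]
        nlinarith [mul_le_mul_of_nonneg_left h3 hC]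
    intro n
    have hcomp : √(1 + C) ≤ √(1 + C) / t := by
      rw [le_div_iff₀ ht0]
      exact mul_le_of_le_one_right (Real.sqrt_nonneg _) ht1.le
    rcases Nat.even_or_odd' n with ⟨k, rfl | rfl⟩
    · rw [two_mul]
      exact (heven U hU0 hU k).trans (mul_le_mul_of_nonneg_right hcomp (by positivity))
    · rw [walkExp_comp_add (2 * k) 1, two_mul, walkExp_comm (k + k) 1]
      refine (walkExp_mono (ψ := fun _ => √(1 + C) * t ^ (k + k)) fun y => ?_).trans ?_
      · simp only [← mem_annSet_map]
        refine heven _ ?_ ?_ k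
        · intro h
          rw [← Submodule.finrank_eq_zero, finrank_map_actW, Submodule.finrank_eq_zero] at h
          exact hU0 h
        · rwa [finrank_map_actW]
      · rw [walkExp_const hne, pow_succ]
        field_simp
        exact le_rfl

open Classical in
/-- A random walk on a Zariski-dense subgroup lies in `annSet U` with exponentially small
probability. -/
lemma exists_walkExp_annSet_le {T : Finset GammaSL} (hT : ∀ s ∈ T, s⁻¹ ∈ T)
    (hne : T.Nonempty) (hd : ZariskiDense (Subgroup.closure (T : Set GammaSL))) :
    ∃ C ρ : ℝ, 0 ≤ C ∧ 0 ≤ ρ ∧ ρ < 1 ∧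
      ∀ U : Submodule ℂ (Fin 3 × Fin 3 → Fin 3 → ℂ), U ≠ ⊥ →
        ∀ n, walkExp T n (fun g => if g ∈ annSet U then 1 else 0) ≤ C * ρ ^ n := by
  obtain ⟨C, ρ, hC, hρ0, hρ1, h⟩ := exists_walkExp_annSet_le_aux hT hne hd 28
  exact ⟨C, ρ, hC, hρ0, hρ1, fun U hU => h U hU (Nat.le_add_left _ _)⟩

/-- The integer matrix of a component of an element of `SL₂(ℤ)³`. -/
def compZ (g : GammaSL) (i : Fin 3) : Matrix (Fin 2) (Fin 2) ℤ :=
  Matrix.of fun a b => entryZ g (i, a, b)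

lemma compZ_mul (g h : GammaSL) (i : Fin 3) : compZ (g * h) i = compZ g i * compZ h i := by
  fin_cases i
  · exact Matrix.SpecialLinearGroup.coe_mul g.1 h.1
  · exact Matrix.SpecialLinearGroup.coe_mul g.2.1 h.2.1
  · exact Matrix.SpecialLinearGroup.coe_mul g.2.2 h.2.2

lemma compZ_one (i : Fin 3) : compZ 1 i = 1 := by
  fin_cases i <;> exact Matrix.SpecialLinearGroup.coe_one

lemma compZ_inv (g : GammaSL) (i : Fin 3) : compZ g⁻¹ i = (compZ g i).adjugate := by
  fin_cases i
  · exact Matrix.SpecialLinearGroup.coe_inv g.1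
  · exact Matrix.SpecialLinearGroup.coe_inv g.2.1
  · exact Matrix.SpecialLinearGroup.coe_inv g.2.2

lemma compZ_mul_inv (g : GammaSL) (i : Fin 3) : compZ g i * compZ g⁻¹ i = 1 := by
  rw [← compZ_mul, mul_inv_cancel, compZ_one]

/-- The coordinates of a traceless matrix. -/
def colCoord (ξ : Matrix (Fin 2) (Fin 2) ℤ) : Fin 3 → ℤ := ![-ξ 0 1, ξ 0 0, ξ 1 0]

lemma trace_conj_mul_eq {ξ η : Matrix (Fin 2) (Fin 2) ℤ} (hξ : ξ.trace = 0) (hη : η.trace = 0)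
    (m : Matrix (Fin 2) (Fin 2) ℤ) : (m * ξ * m.adjugate * η).trace =
      ∑ j, ∑ k, symSq m j k * (![1, 2, 1] j * colCoord ηᵀ j * colCoord ξ k) := by
  rw [Matrix.trace_fin_two] at hξ hη
  have h1 : ξ 1 1 = -ξ 0 0 := by linear_combination hξ
  have h2 : η 1 1 = -η 0 0 := by linear_combination hη
  rw [Matrix.adjugate_fin_two]
  simp only [Matrix.trace_fin_two, Matrix.mul_apply, Fin.sum_univ_two, Fin.sum_univ_three, symSq,
    colCoord, Matrix.transpose_apply, Matrix.of_apply, Matrix.cons_val, h1, h2]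
  ring

/-- The sum of the conjugation-trace functions. -/
def kappa (ξ η : Fin 3 → Matrix (Fin 2) (Fin 2) ℤ) (g : GammaSL) : ℤ :=
  ∑ i, (compZ g i * ξ i * compZ g⁻¹ i * η i).trace

lemma kappa_mul (ξ η : Fin 3 → Matrix (Fin 2) (Fin 2) ℤ) (x y : GammaSL) :
    kappa ξ η (x * y) = kappa ξ (fun i => compZ x⁻¹ i * η i * compZ x i) y := by
  refine Finset.sum_congr rfl fun i _ => ?_
  rw [_root_.mul_inv_rev, compZ_mul, compZ_mul]
  simp only [Matrix.mul_assoc]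
  rw [Matrix.trace_mul_comm]
  simp only [Matrix.mul_assoc]

/-- The vector of matrix coefficients of the symmetric squares of the components. -/
def symVec (g : GammaSL) (a : Fin 3 × Fin 3 × Fin 3) : ℤ := symSq (compZ g a.1) a.2.1 a.2.2

lemma kappa_eq_dotProduct {ξ η : Fin 3 → Matrix (Fin 2) (Fin 2) ℤ} (hξ : ∀ i, (ξ i).trace = 0)
    (hη : ∀ i, (η i).trace = 0) (g : GammaSL) : kappa ξ η g =
      symVec g ⬝ᵥ fun a => ![1, 2, 1] a.2.1 * colCoord (η a.1)ᵀ a.2.1 * colCoord (ξ a.1) a.2.2 := by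
  simp only [kappa, compZ_inv, trace_conj_mul_eq (hξ _) (hη _), dotProduct,
    Fintype.sum_prod_type]
  rfl

lemma exists_not_dvd_colCoord {ξ : Matrix (Fin 2) (Fin 2) ℤ} (hξ : ξ.trace = 0) {p : ℤ}
    (h : ∃ a b, ¬ p ∣ ξ a b) : ∃ k, ¬ p ∣ colCoord ξ k := by
  by_contra! hcon
  obtain ⟨a, b, hab⟩ := h
  apply hab
  rw [Matrix.trace_fin_two] at hξ
  have h11 : ξ 1 1 = -ξ 0 0 := by linear_combination hξ
  have h0 := hcon 0
  have h1 := hcon 1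
  have h2 := hcon 2
  simp only [colCoord, Matrix.cons_val, dvd_neg] at h0 h1 h2
  fin_cases a <;> fin_cases b
  · exact h1
  · exact h0
  · exact h2
  · change p ∣ ξ 1 1
    rw [h11, dvd_neg]
    exact h1

/-- If `Q` divides all multiples `D * e a` and no prime factor of `Q` divides all `e a`, then
`Q ∣ D`. -/
lemma dvd_of_forall_dvd_mul {Q : ℕ} {D : ℤ} {ι : Type*} [Fintype ι] {e : ι → ℤ}
    (h : ∀ a, (Q : ℤ) ∣ D * e a) (he : ∀ p : ℕ, p.Prime → p ∣ Q → ∃ a, ¬ (p : ℤ) ∣ e a) :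
    (Q : ℤ) ∣ D := by
  have h1 : (Q : ℤ) ∣ Finset.univ.gcd fun a => D * e a := Finset.dvd_gcd fun a _ => h a
  rw [Finset.gcd_mul_left] at h1
  have hcop : IsCoprime (Q : ℤ) (Finset.univ.gcd e) := by
    rw [Int.isCoprime_iff_gcd_eq_one, Int.gcd, Int.natAbs_natCast]
    by_contra hcon
    obtain ⟨p, hp, hpQ, hpe⟩ := Nat.Prime.not_coprime_iff_dvd.1 hcon
    obtain ⟨a, ha⟩ := he p hp hpQ
    exact ha ((Int.natCast_dvd.2 hpe).trans (Finset.gcd_dvd (Finset.mem_univ a)))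
  exact (hcop.dvd_of_dvd_mul_right h1).trans (normalize_associated D).dvd

/-- If `Q` divides all multiples by `D` of the coefficients of the conjugation-trace functional of
two primitive traceless matrices, then `Q ∣ 2 * D`. -/
lemma dvd_two_mul_of_dvd_mul_colCoord {Q : ℕ} {ξ η : Matrix (Fin 2) (Fin 2) ℤ} (hξ : ξ.trace = 0)
    (hη : η.trace = 0) (hξp : ∀ p : ℕ, p.Prime → p ∣ Q → ∃ a b, ¬ (p : ℤ) ∣ ξ a b)
    (hηp : ∀ p : ℕ, p.Prime → p ∣ Q → ∃ a b, ¬ (p : ℤ) ∣ η a b) {D : ℤ}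
    (h : ∀ j k : Fin 3, (Q : ℤ) ∣ D * (![1, 2, 1] j * colCoord ηᵀ j * colCoord ξ k)) :
    (Q : ℤ) ∣ 2 * D := by
  refine dvd_of_forall_dvd_mul (e := fun a : Fin 3 × Fin 3 => colCoord ηᵀ a.1 * colCoord ξ a.2)
    (fun a => ?_) fun p hp hpQ => ?_
  · refine (h a.1 a.2).trans ?_
    have : (![1, 2, 1] a.1 : ℤ) ∣ 2 := by
      obtain ⟨j, k⟩ := a
      fin_cases j <;> simp
    obtain ⟨d, hd⟩ := this
    refine ⟨d, ?_⟩
    linear_combination D * (colCoord ηᵀ a.1 * colCoord ξ a.2) * hd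
  · obtain ⟨k, hk⟩ := exists_not_dvd_colCoord hξ (hξp p hp hpQ)
    obtain ⟨a, b, hab⟩ := hηp p hp hpQ
    obtain ⟨j, hj⟩ := exists_not_dvd_colCoord (ξ := ηᵀ) (by rwa [Matrix.trace_transpose])
      ⟨b, a, hab⟩
    refine ⟨(j, k), fun hjk => ?_⟩
    rcases (Nat.prime_iff_prime_int.1 hp).dvd_or_dvd hjk with h | h
    · exact hj h
    · exact hk h

lemma dvd_det_mul {n : Type*} [Fintype n] [DecidableEq n] {A : Matrix n n ℤ} {t : n → ℤ} {q : ℤ}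
    (h : ∀ a, q ∣ (A *ᵥ t) a) (a : n) : q ∣ A.det * t a := by
  have : (A.adjugate *ᵥ (A *ᵥ t)) a = A.det * t a := by
    rw [Matrix.mulVec_mulVec, Matrix.adjugate_mul, Matrix.smul_mulVec, Matrix.one_mulVec]
    rfl
  rw [← this]
  exact Finset.dvd_sum fun b _ => Dvd.dvd.mul_left (h b) _

/-- Integer vectors either contain a nonsingular square matrix, or are annihilated by a common
nonzero functional. -/
lemma exists_det_ne_zero_or_exists_dotProduct_eq_zero {n X : Type*} [Fintype n] [DecidableEq n]
    (s : Set X) (v : X → n → ℤ) :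
    (∃ x : n → X, (∀ a, x a ∈ s) ∧ (Matrix.of fun a => v (x a)).det ≠ 0) ∨
      ∃ f : n → ℂ, f ≠ 0 ∧ ∀ x ∈ s, (fun a => (v x a : ℂ)) ⬝ᵥ f = 0 := by
  set V : X → n → ℂ := fun x a => (v x a : ℂ) with hV
  by_cases htop : Submodule.span ℂ (V '' s) = ⊤
  · left
    obtain ⟨b, hbs, hspan, hli⟩ := exists_linearIndependent ℂ (V '' s)
    set B := Module.Basis.mk hli (by rw [Subtype.range_coe, hspan, htop]) with hB
    let e := B.indexEquiv (Pi.basisFun ℂ n)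
    choose x hx hxe using fun a => hbs (e.symm a).2
    refine ⟨x, hx, fun hdet => ?_⟩
    have hli' : LinearIndependent ℂ (fun a => V (x a)) := by
      simp only [hxe]
      exact hli.comp _ e.symm.injective
    have hunit := Matrix.linearIndependent_rows_iff_isUnit.1
      (show LinearIndependent ℂ (Matrix.of fun a => V (x a)).row from hli')
    rw [Matrix.isUnit_iff_isUnit_det] at hunit
    apply hunit.ne_zero
    have : (Matrix.of fun a => V (x a)) =
        (Matrix.of fun a => v (x a)).map (Int.castRingHom ℂ) := rfl
    rw [this, ← RingHom.mapMatrix_apply, ← RingHom.map_det, hdet, map_zero]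
  · right
    obtain ⟨f, hf0, hf⟩ := Submodule.exists_le_ker_of_lt_top _ (lt_top_iff_ne_top.2 htop)
    have hfd : ∀ y, f y = y ⬝ᵥ fun a => f (Pi.single a 1) := by
      intro y
      conv_lhs => rw [← Finset.univ_sum_single y, map_sum]
      refine Finset.sum_congr rfl fun a _ => ?_
      have : (Pi.single a (y a) : n → ℂ) = y a • Pi.single a 1 := by
        rw [← Pi.single_smul, smul_eq_mul, mul_one]
      rw [this, map_smul, smul_eq_mul]
    refine ⟨fun a => f (Pi.single a 1), fun h => hf0 (LinearMap.ext fun y => ?_), fun x hx => ?_⟩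
    · rw [hfd, h, dotProduct_zero]
      rfl
    · rw [← hfd]
      exact hf (Submodule.subset_span ⟨x, hx, rfl⟩)

/-- Group elements whose entries are bounded by `K ^ n`. -/
def entryBall (K : ℤ) (n : ℕ) : Set GammaSL := {g | ∀ i a b, |compZ g i a b| ≤ K ^ n}

lemma one_mem_entryBall (K : ℤ) : 1 ∈ entryBall K 0 := by
  intro i a b
  rw [compZ_one, Matrix.one_apply]
  split_ifs <;> simp

/-- The entries of a product of `n` elements of a finite set grow at most exponentially. -/
lemma exists_mul_mem_entryBall (T : Finset GammaSL) :
    ∃ K : ℤ, 1 ≤ K ∧ ∀ n, ∀ x ∈ entryBall K n, ∀ s ∈ T, x * s ∈ entryBall K (n + 1) := by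
  set K₀ : ℤ := ∑ s ∈ T, ∑ i, ∑ a, ∑ b, |compZ s i a b| with hK₀
  have hK : ∀ s ∈ T, ∀ i a b, |compZ s i a b| ≤ K₀ := by
    intro s hs i a b
    calc |compZ s i a b| ≤ ∑ b, |compZ s i a b| :=
          Finset.single_le_sum (f := fun b => |compZ s i a b|) (fun _ _ => abs_nonneg _)
            (Finset.mem_univ b)
      _ ≤ ∑ a, ∑ b, |compZ s i a b| :=
          Finset.single_le_sum (f := fun a => ∑ b, |compZ s i a b|)
            (fun _ _ => Finset.sum_nonneg fun _ _ => abs_nonneg _) (Finset.mem_univ a)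
      _ ≤ ∑ i, ∑ a, ∑ b, |compZ s i a b| :=
          Finset.single_le_sum (f := fun i => ∑ a, ∑ b, |compZ s i a b|)
            (fun _ _ => Finset.sum_nonneg fun _ _ => Finset.sum_nonneg fun _ _ => abs_nonneg _)
            (Finset.mem_univ i)
      _ ≤ K₀ :=
          Finset.single_le_sum (f := fun s => ∑ i, ∑ a, ∑ b, |compZ s i a b|)
            (fun _ _ => Finset.sum_nonneg fun _ _ => Finset.sum_nonneg fun _ _ =>
              Finset.sum_nonneg fun _ _ => abs_nonneg _) hs
  have hK₀0 : 0 ≤ K₀ := Finset.sum_nonneg fun _ _ => Finset.sum_nonneg fun _ _ =>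
    Finset.sum_nonneg fun _ _ => Finset.sum_nonneg fun _ _ => abs_nonneg _
  refine ⟨2 * K₀ + 1, by linarith, fun n x hx s hs i a b => ?_⟩
  rw [compZ_mul, Matrix.mul_apply, Fin.sum_univ_two]
  have hpow : 0 ≤ (2 * K₀ + 1) ^ n := by positivity
  have h : ∀ c, |compZ x i a c * compZ s i c b| ≤ (2 * K₀ + 1) ^ n * K₀ := by
    intro c
    rw [abs_mul]
    exact mul_le_mul (hx i a c) (hK s hs i c b) (abs_nonneg _) hpow
  refine (abs_add_le _ _).trans ?_
  rw [pow_succ]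
  linarith [h 0, h 1]

lemma abs_symVec_le {K : ℤ} {n : ℕ} {g : GammaSL} (hg : g ∈ entryBall K n)
    (a : Fin 3 × Fin 3 × Fin 3) : |symVec g a| ≤ 2 * (K ^ n) ^ 2 := by
  obtain ⟨i, j, k⟩ := a
  have h : ∀ a b c d, |compZ g i a b * compZ g i c d| ≤ (K ^ n) ^ 2 := by
    intro a b c d
    rw [abs_mul, sq]
    exact mul_le_mul (hg i a b) (hg i c d) (abs_nonneg _) ((abs_nonneg _).trans (hg i a b))
  have h1 : ∀ a b c d, compZ g i a b * compZ g i c d ≤ (K ^ n) ^ 2 := fun a b c d =>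
    (abs_le.1 (h a b c d)).2
  have h2 : ∀ a b c d, -(K ^ n) ^ 2 ≤ compZ g i a b * compZ g i c d := fun a b c d =>
    (abs_le.1 (h a b c d)).1
  have h3 : 0 ≤ (K ^ n) ^ 2 := sq_nonneg _
  rw [abs_le]
  fin_cases j <;> fin_cases k <;>
    simp only [symVec, symSq, Matrix.of_apply, Matrix.cons_val, Fin.zero_eta, Fin.mk_one,
      Fin.reduceFinMk] <;> constructor
  · linarith [h2 0 0 0 0]
  · linarith [h1 0 0 0 0]
  · linarith [h2 0 0 0 1]
  · linarith [h1 0 0 0 1]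
  · linarith [h2 0 1 0 1]
  · linarith [h1 0 1 0 1]
  · linarith [h2 0 0 1 0]
  · linarith [h1 0 0 1 0]
  · linarith [h2 0 0 1 1, h2 0 1 1 0]
  · linarith [h1 0 0 1 1, h1 0 1 1 0]
  · linarith [h2 0 1 1 1]
  · linarith [h1 0 1 1 1]
  · linarith [h2 1 0 1 0]
  · linarith [h1 1 0 1 0]
  · linarith [h2 1 0 1 1]
  · linarith [h1 1 0 1 1]
  · linarith [h2 1 1 1 1]
  · linarith [h1 1 1 1 1]

lemma evW_actW_eq_dotProduct (f : Fin 3 × Fin 3 × Fin 3 → ℂ) (g : GammaSL) :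
    evW (actW g fun p k => f (p.1, p.2, k)) = (fun a => (symVec g a : ℂ)) ⬝ᵥ f := by
  have h : ∀ i j k, symSq (compC g i) j k = (symVec g (i, j, k) : ℂ) := by
    intro i j k
    have hc : ∀ a b, compC g i a b = (compZ g i a b : ℂ) := fun a b => rfl
    fin_cases j <;> fin_cases k <;> simp [symVec, symSq, hc]
  simp only [evW_apply, actW_apply, Matrix.mulVec, dotProduct, Fintype.sum_prod_type, h]

open Classical in
/-- Non-concentration for walks so short that the matrix coefficients are small compared with
the modulus. -/
lemma exists_walkExp_kappa_le {T : Finset GammaSL} (hT : ∀ s ∈ T, s⁻¹ ∈ T) (hne : T.Nonempty)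
    (hd : ZariskiDense (Subgroup.closure (T : Set GammaSL))) :
    ∃ C ρ : ℝ, 0 ≤ C ∧ 0 ≤ ρ ∧ ρ < 1 ∧ ∃ A K : ℝ, 0 < A ∧ 1 ≤ K ∧ ∀ (n Q : ℕ), A * K ^ n < Q →
      ∀ ξ η : Fin 3 → Matrix (Fin 2) (Fin 2) ℤ,
        (∀ i, (ξ i).trace = 0) → (∀ i, (η i).trace = 0) →
        (∀ p : ℕ, p.Prime → p ∣ Q → ∀ i, ∃ a b, ¬ (p : ℤ) ∣ ξ i a b) →
        (∀ p : ℕ, p.Prime → p ∣ Q → ∀ i, ∃ a b, ¬ (p : ℤ) ∣ η i a b) →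
        walkExp T n (fun g => if (Q : ℤ) ∣ kappa ξ η g then 1 else 0) ≤ C * ρ ^ n := by
  obtain ⟨C, ρ, hC, hρ0, hρ1, hann⟩ := exists_walkExp_annSet_le hT hne hd
  obtain ⟨K, hK1, hK⟩ := exists_mul_mem_entryBall T
  refine ⟨C, ρ, hC, hρ0, hρ1, 2 * (Nat.factorial 27 * 2 ^ 27), (K : ℝ) ^ 54, by positivity,
    one_le_pow₀ (by exact_mod_cast hK1), fun n Q hQ ξ η hξ hη hξp hηp => ?_⟩
  set t : Fin 3 × Fin 3 × Fin 3 → ℤ := fun a =>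
    ![1, 2, 1] a.2.1 * colCoord (η a.1)ᵀ a.2.1 * colCoord (ξ a.1) a.2.2 with ht
  have hcongr : walkExp T n (fun g => if (Q : ℤ) ∣ kappa ξ η g then (1 : ℝ) else 0) =
      walkExp T n (fun g => if g ∈ entryBall K n ∧ (Q : ℤ) ∣ kappa ξ η g then 1 else 0) :=
    walkExp_congr_of_mem (B := entryBall K) (one_mem_entryBall K) hK fun g hg => by simp [hg]
  rw [hcongr]
  rcases exists_det_ne_zero_or_exists_dotProduct_eq_zero
    {g | g ∈ entryBall K n ∧ (Q : ℤ) ∣ kappa ξ η g} symVec with ⟨x, hx, hdet⟩ | ⟨f, hf0, hf⟩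
  · exfalso
    set M : Matrix (Fin 3 × Fin 3 × Fin 3) (Fin 3 × Fin 3 × Fin 3) ℤ :=
      Matrix.of fun a => symVec (x a) with hM
    have hdvd : ∀ a, (Q : ℤ) ∣ (M *ᵥ t) a := by
      intro a
      have := (hx a).2
      rwa [kappa_eq_dotProduct hξ hη] at this
    have h2 : (Q : ℤ) ∣ 2 * M.det := dvd_two_mul_of_dvd_mul_colCoord (hξ 0) (hη 0)
      (fun p hp hpQ => hξp p hp hpQ 0) (fun p hp hpQ => hηp p hp hpQ 0)
      fun j k => dvd_det_mul hdvd (0, j, k)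
    have h3 : (Q : ℤ) ≤ |2 * M.det| :=
      Int.le_of_dvd (abs_pos.2 (mul_ne_zero two_ne_zero hdet)) ((dvd_abs _ _).2 h2)
    have h4 := Matrix.det_le (A := M) (abv := AbsoluteValue.abs) (x := 2 * (K ^ n) ^ 2)
      fun a b => abs_symVec_le (hx a).1 b
    have h5 : |M.det| ≤ Nat.factorial 27 * (2 * (K ^ n) ^ 2) ^ 27 := by
      have hcard : Fintype.card (Fin 3 × Fin 3 × Fin 3) = 27 := rfl
      rw [hcard, nsmul_eq_mul] at h4
      exact h4
    rw [abs_mul, abs_two] at h3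
    have h6 : (Q : ℤ) ≤ 2 * (Nat.factorial 27 * 2 ^ 27) * (K ^ 54) ^ n := by
      calc (Q : ℤ) ≤ 2 * (Nat.factorial 27 * (2 * (K ^ n) ^ 2) ^ 27) := by linarith
        _ = _ := by ring
    have h7 : (Q : ℝ) ≤ 2 * (Nat.factorial 27 * 2 ^ 27) * ((K : ℝ) ^ 54) ^ n := by
      exact_mod_cast h6
    exact absurd hQ (not_lt.2 h7)
  · refine (walkExp_mono fun g => ?_).trans
      (hann (Submodule.span ℂ {fun p k => f (p.1, p.2, k)}) ?_ n)
    · by_cases hg : g ∈ entryBall K n ∧ (Q : ℤ) ∣ kappa ξ η g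
      · rw [if_pos hg, if_pos]
        intro w hw
        obtain ⟨c, rfl⟩ := Submodule.mem_span_singleton.1 hw
        rw [map_smul, map_smul, evW_actW_eq_dotProduct, hf g hg, smul_zero]
      · rw [if_neg hg]
        split_ifs <;> norm_num
    · rw [Ne, Submodule.span_singleton_eq_bot]
      intro h
      exact hf0 (funext fun a => congrFun (congrFun h (a.1, a.2.1)) a.2.2)

open Classical in
/-- Non-concentration for long walks. -/
lemma walkExp_kappa_le_of_le {T : Finset GammaSL} (hne : T.Nonempty) {n l Q : ℕ} (hnl : n ≤ l)
    {δ : ℝ} (h : ∀ ξ η : Fin 3 → Matrix (Fin 2) (Fin 2) ℤ,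
        (∀ i, (ξ i).trace = 0) → (∀ i, (η i).trace = 0) →
        (∀ p : ℕ, p.Prime → p ∣ Q → ∀ i, ∃ a b, ¬ (p : ℤ) ∣ ξ i a b) →
        (∀ p : ℕ, p.Prime → p ∣ Q → ∀ i, ∃ a b, ¬ (p : ℤ) ∣ η i a b) →
        walkExp T n (fun g => if (Q : ℤ) ∣ kappa ξ η g then 1 else 0) ≤ δ)
    {ξ η : Fin 3 → Matrix (Fin 2) (Fin 2) ℤ}
    (hξ : ∀ i, (ξ i).trace = 0) (hη : ∀ i, (η i).trace = 0)
    (hξp : ∀ p : ℕ, p.Prime → p ∣ Q → ∀ i, ∃ a b, ¬ (p : ℤ) ∣ ξ i a b)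
    (hηp : ∀ p : ℕ, p.Prime → p ∣ Q → ∀ i, ∃ a b, ¬ (p : ℤ) ∣ η i a b) :
    walkExp T l (fun g => if (Q : ℤ) ∣ kappa ξ η g then 1 else 0) ≤ δ := by
  obtain ⟨m, rfl⟩ := Nat.exists_eq_add_of_le' hnl
  rw [walkExp_comp_add]
  refine (walkExp_mono (ψ := fun _ => δ) fun x => ?_).trans (walkExp_const hne m δ).le
  simp only [kappa_mul]
  refine h _ _ hξ (fun i => ?_) hξp fun p hp hpQ i => ?_
  · rw [Matrix.trace_mul_comm, ← Matrix.mul_assoc, compZ_mul_inv, Matrix.one_mul, hη]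
  · by_contra! hcon
    obtain ⟨a, b, hab⟩ := hηp p hp hpQ i
    apply hab
    have hconj : η i = compZ x i * (compZ x⁻¹ i * η i * compZ x i) * compZ x⁻¹ i := by
      simp only [Matrix.mul_assoc]
      rw [compZ_mul_inv, Matrix.mul_one, ← Matrix.mul_assoc, compZ_mul_inv, Matrix.one_mul]
    rw [hconj, Matrix.mul_apply]
    refine Finset.dvd_sum fun c _ => Dvd.dvd.mul_right ?_ _
    rw [Matrix.mul_apply]
    exact Finset.dvd_sum fun d _ => Dvd.dvd.mul_left (hcon d c) _

lemma ZariskiDense.nonempty {T : Finset GammaSL}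
    (hd : ZariskiDense (Subgroup.closure (T : Set GammaSL))) : T.Nonempty := by
  rw [Finset.nonempty_iff_ne_empty]
  rintro rfl
  have := hd.eq_zero (entry_mem_polyFun 0 0 1) (fun g hg => by
    rw [Finset.coe_empty, Subgroup.closure_empty, Subgroup.mem_bot] at hg
    rw [hg, compC_one]
    simp) (fun _ => !![1, 1; 0, 1]) (fun _ => by simp)
  simp at this

/-- Choice of the walk length in terms of the modulus. -/
lemma exists_exponent {C ρ A K : ℝ} (hC : 0 ≤ C) (hρ0 : 0 ≤ ρ) (hρ1 : ρ < 1) (hA : 0 < A)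
    (hK : 1 ≤ K) : ∃ c : ℝ, 0 < c ∧ ∃ Q₀ : ℕ, ∀ Q : ℕ, Q₀ ≤ Q →
      ∃ n : ℕ, (n : ℝ) ≤ Real.log Q ∧ A * K ^ n < Q ∧ C * ρ ^ n < (Q : ℝ) ^ (-c) := by
  set σ := max ρ (1 / 2) with hσ
  have hσ0 : 0 < σ := lt_max_of_lt_right (by norm_num)
  have hσ1 : σ < 1 := max_lt hρ1 (by norm_num)
  set L := max (Real.log K) 1 with hL
  have hL1 : 1 ≤ L := le_max_right _ _
  have hL0 : 0 < L := one_pos.trans_le hL1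
  set μ := -Real.log σ with hμ
  have hμ0 : 0 < μ := neg_pos.2 (Real.log_neg hσ0 hσ1)
  set c := μ / (4 * L) with hc
  have hc0 : 0 < c := by positivity
  have hev1 : ∀ᶠ Q : ℕ in Filter.atTop, C * Real.exp μ < (Q : ℝ) ^ c :=
    ((tendsto_rpow_atTop hc0).comp tendsto_natCast_atTop_atTop).eventually_gt_atTop _
  have hev2 : ∀ᶠ Q : ℕ in Filter.atTop, A ^ 2 + 1 < (Q : ℝ) :=
    tendsto_natCast_atTop_atTop.eventually_gt_atTop _
  obtain ⟨Q₀, hQ₀⟩ := Filter.eventually_atTop.1 (hev1.and hev2)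
  refine ⟨c, hc0, Q₀, fun Q hQ => ?_⟩
  obtain ⟨h1, h2⟩ := hQ₀ Q hQ
  have hQ1 : (1 : ℝ) < Q := by nlinarith
  have hQ0 : (0 : ℝ) < Q := one_pos.trans hQ1
  have hlog : 0 < Real.log Q := Real.log_pos hQ1
  set n := ⌊Real.log Q / (2 * L)⌋₊ with hn
  have hn1 : (n : ℝ) ≤ Real.log Q / (2 * L) := Nat.floor_le (by positivity)
  have hn2 : Real.log Q / (2 * L) < n + 1 := Nat.lt_floor_add_one _
  have hn3 : n * L ≤ Real.log Q / 2 := by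
    rw [le_div_iff₀ (by positivity)] at hn1
    linarith
  refine ⟨n, ?_, ?_, ?_⟩
  · refine hn1.trans (div_le_self hlog.le (by linarith))
  · have hKn : K ^ n ≤ √Q := by
      rw [Real.sqrt_eq_rpow, Real.rpow_def_of_pos hQ0, ← Real.exp_log (pow_pos (one_pos.trans_le hK) n),
        Real.exp_le_exp, Real.log_pow]
      refine (mul_le_mul_of_nonneg_left (le_max_left _ 1) (Nat.cast_nonneg n)).trans ?_
      linarith
    have hAQ : A < √Q := Real.lt_sqrt_of_sq_lt (by linarith)
    calc A * K ^ n ≤ A * √Q := mul_le_mul_of_nonneg_left hKn hA.le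
      _ < √Q * √Q := mul_lt_mul_of_pos_right hAQ (Real.sqrt_pos.2 hQ0)
      _ = Q := Real.mul_self_sqrt hQ0.le
  · have hσn : σ ^ n ≤ Real.exp μ * ((Q : ℝ) ^ (-c) * (Q : ℝ) ^ (-c)) := by
      rw [Real.rpow_def_of_pos hQ0, ← Real.exp_add, ← Real.exp_add, ← Real.exp_log (pow_pos hσ0 n),
        Real.exp_le_exp, Real.log_pow]
      have : Real.log Q * c = μ * (Real.log Q / (2 * L)) / 2 := by
        rw [hc]
        field_simp
        norm_num
      have hlogσ : Real.log σ = -μ := by rw [hμ, neg_neg]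
      rw [hlogσ]
      nlinarith [mul_le_mul_of_nonneg_left hn2.le hμ0.le]
    have hpow : (0 : ℝ) < (Q : ℝ) ^ (-c) := Real.rpow_pos_of_pos hQ0 _
    calc C * ρ ^ n ≤ C * σ ^ n :=
          mul_le_mul_of_nonneg_left (pow_le_pow_left₀ hρ0 (le_max_left _ _) n) hC
      _ ≤ C * (Real.exp μ * ((Q : ℝ) ^ (-c) * (Q : ℝ) ^ (-c))) :=
          mul_le_mul_of_nonneg_left hσn hC
      _ = C * Real.exp μ * (Q : ℝ) ^ (-c) * (Q : ℝ) ^ (-c) := by ring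
      _ < (Q : ℝ) ^ c * (Q : ℝ) ^ (-c) * (Q : ℝ) ^ (-c) :=
          mul_lt_mul_of_pos_right (mul_lt_mul_of_pos_right h1 hpow) hpow
      _ = (Q : ℝ) ^ (-c) := by
          rw [← Real.rpow_add hQ0, add_neg_cancel, Real.rpow_zero, one_mul]

/-- Non-concentration of random walks on fibers of sums of
conjugation-trace functions `κᵢ(g) = Tr(g ξᵢ g⁻¹ ηᵢ)`. -/
theorem statement8 (S : Set GammaSL) (hfin : S.Finite) (hsym : S⁻¹ = S)
    (hdense : ZariskiDense (Subgroup.closure S)) :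
    ∃ c : ℝ, 0 < c ∧ ∃ Q₀ : ℕ, ∀ Q : ℕ, Q₀ ≤ Q →
      ∀ ξ η : Fin 3 → Matrix (Fin 2) (Fin 2) ℤ,
        (∀ i, (ξ i).trace = 0) → (∀ i, (η i).trace = 0) →
        (∀ p : ℕ, p.Prime → p ∣ Q → ∀ i, ∃ a b, ¬ (p : ℤ) ∣ ξ i a b) →
        (∀ p : ℕ, p.Prime → p ∣ Q → ∀ i, ∃ a b, ¬ (p : ℤ) ∣ η i a b) →
        ∀ l : ℕ, Real.log Q < (l : ℝ) →
          (∑ᶠ g ∈ {g : GammaSL |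
              ((g.1 : Matrix (Fin 2) (Fin 2) ℤ) * ξ 0 * ((g.1⁻¹ : SL2Z) : Matrix (Fin 2) (Fin 2) ℤ) * η 0).trace +
              ((g.2.1 : Matrix (Fin 2) (Fin 2) ℤ) * ξ 1 * ((g.2.1⁻¹ : SL2Z) : Matrix (Fin 2) (Fin 2) ℤ) * η 1).trace +
              ((g.2.2 : Matrix (Fin 2) (Fin 2) ℤ) * ξ 2 * ((g.2.2⁻¹ : SL2Z) : Matrix (Fin 2) (Fin 2) ℤ) * η 2).trace
                ≡ 0 [ZMOD (Q : ℤ)]}, chiIter S l g) < (Q : ℝ) ^ (-c) := by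
  classical
  have hT : ∀ s ∈ hfin.toFinset, s⁻¹ ∈ hfin.toFinset := by
    intro s hs
    rw [Set.Finite.mem_toFinset] at hs ⊢
    rw [← hsym]
    exact Set.inv_mem_inv.2 hs
  have hd : ZariskiDense (Subgroup.closure (hfin.toFinset : Set GammaSL)) := by
    rwa [Set.Finite.coe_toFinset]
  obtain ⟨C, ρ, hC, hρ0, hρ1, A, K, hA, hK, hwalk⟩ := exists_walkExp_kappa_le hT hd.nonempty hd
  obtain ⟨c, hc, Q₀, hQ₀⟩ := exists_exponent hC hρ0 hρ1 hA hK
  refine ⟨c, hc, Q₀, fun Q hQ ξ η hξ hη hξp hηp l hl => ?_⟩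
  obtain ⟨n, hn, hAK, hlt⟩ := hQ₀ Q hQ
  have hnl : n ≤ l := by exact_mod_cast (hn.trans hl.le)
  rw [finsum_chiIter_eq_walkExp hfin]
  refine lt_of_le_of_lt (le_of_eq_of_le ?_
    (walkExp_kappa_le_of_le hd.nonempty hnl (hwalk n Q hAK) hξ hη hξp hηp)) hlt
  congr 1
  funext g
  have : kappa ξ η g =
      ((g.1 : Matrix (Fin 2) (Fin 2) ℤ) * ξ 0 * ((g.1⁻¹ : SL2Z) : Matrix (Fin 2) (Fin 2) ℤ) * η 0).trace +
      ((g.2.1 : Matrix (Fin 2) (Fin 2) ℤ) * ξ 1 * ((g.2.1⁻¹ : SL2Z) : Matrix (Fin 2) (Fin 2) ℤ) * η 1).trace +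
      ((g.2.2 : Matrix (Fin 2) (Fin 2) ℤ) * ξ 2 * ((g.2.2⁻¹ : SL2Z) : Matrix (Fin 2) (Fin 2) ℤ) * η 2).trace := by
    rw [kappa, Fin.sum_univ_three]
    rfl
  rw [Set.mem_ofPred_eq, Int.modEq_zero_iff_dvd, ← this]
  split_ifs <;> rfl
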